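/- Let n ≥ 5 and n/(n-4) < p < (n+4)/(n-4), and let u be a nonnegative C⁴ solution of Δ²u = u^p in ℝⁿ\{0}. Then −Δu is superharmonic in ℝⁿ in the distributional sense: for every nonnegative smooth compactly supported function φ : ℝⁿ → ℝ one has ∫_{ℝⁿ} Δu · Δφ dx = ∫_{ℝⁿ} u^p φ dx ≥ 0. Moreover, −Δu(x) ≥ 0 for all x ∈ ℝⁿ\{0}. -/

import Mathlib

open MeasureTheory Metric Filter

/-- The Euclidean Laplacian `Δu` of `u : ℝⁿ → ℝ`, computed as the trace of the second
derivative: `Δu(x) = ∑ i, ∂²u/∂xᵢ²(x)`. -/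
noncomputable def lap {n : ℕ} (u : EuclideanSpace ℝ (Fin n) → ℝ) :
    EuclideanSpace ℝ (Fin n) → ℝ :=
  fun x => ∑ i : Fin n,
    iteratedFDeriv ℝ 2 u x ![EuclideanSpace.single i 1, EuclideanSpace.single i 1]

/-- The biharmonic operator `Δ²u = Δ(Δu)`. -/
noncomputable def bilap {n : ℕ} (u : EuclideanSpace ℝ (Fin n) → ℝ) :
    EuclideanSpace ℝ (Fin n) → ℝ :=
  lap (lap u)

/-- The partial derivative of `f` in the `i`-th coordinate direction. -/
noncomputable def pd {n : ℕ} (i : Fin n) (f : EuclideanSpace ℝ (Fin n) → ℝ) :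
    EuclideanSpace ℝ (Fin n) → ℝ :=
  fun x => fderiv ℝ f x (EuclideanSpace.single i 1)

section Calculus

variable {n : ℕ} {f g : EuclideanSpace ℝ (Fin n) → ℝ}

lemma pd_contDiff (i : Fin n) (hf : ContDiff ℝ (⊤ : ℕ∞) f) : ContDiff ℝ (⊤ : ℕ∞) (pd i f) :=
  (hf.fderiv_right (by simp)).clm_apply contDiff_const

lemma tsupport_pd_subset (i : Fin n) : tsupport (pd i f) ⊆ tsupport f :=
  tsupport_fderiv_apply_subset ℝ _

lemma pd_hasCompactSupport (i : Fin n) (hf : HasCompactSupport f) :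
    HasCompactSupport (pd i f) :=
  hf.mono' (subset_closure.trans (tsupport_pd_subset i))

lemma pd_contDiffOn {U : Set (EuclideanSpace ℝ (Fin n))} (hU : IsOpen U) (i : Fin n) {k : ℕ}
    (hf : ContDiffOn ℝ (k + 1) f U) : ContDiffOn ℝ k (pd i f) U :=
  (hf.fderiv_of_isOpen hU le_rfl).clm_apply contDiffOn_const

lemma lap_eq_sum_pd_of_contDiffAt {x : EuclideanSpace ℝ (Fin n)} (hf : ContDiffAt ℝ 2 f x) :
    lap f x = ∑ i, pd i (pd i f) x := by
  unfold lap
  refine Finset.sum_congr rfl fun i _ => ?_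
  rw [iteratedFDeriv_two_apply]
  have h1 : DifferentiableAt ℝ (fderiv ℝ f) x :=
    (hf.fderiv_right (m := 1) (by norm_num)).differentiableAt (by norm_num)
  unfold pd
  rw [fderiv_clm_apply h1 (differentiableAt_const _)]
  simp

lemma lap_eq_sum_pd (hf : ContDiff ℝ (⊤ : ℕ∞) f) : lap f = fun x => ∑ i, pd i (pd i f) x :=
  funext fun _ => lap_eq_sum_pd_of_contDiffAt
    (contDiff_infty.mp hf 2).contDiffAt

lemma lap_contDiff (hf : ContDiff ℝ (⊤ : ℕ∞) f) : ContDiff ℝ (⊤ : ℕ∞) (lap f) := by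
  rw [lap_eq_sum_pd hf]
  exact ContDiff.sum fun i _ => pd_contDiff i (pd_contDiff i hf)

lemma tsupport_lap_subset : tsupport (lap f) ⊆ tsupport f := by
  refine closure_minimal (fun x hx => ?_) (isClosed_tsupport f)
  by_contra h
  refine hx ?_
  have : iteratedFDeriv ℝ 2 f x = 0 := by
    by_contra h'
    exact h (support_iteratedFDeriv_subset 2 h')
  simp [lap, this]

lemma lap_hasCompactSupport (hf : HasCompactSupport f) : HasCompactSupport (lap f) :=
  hf.mono' (subset_closure.trans tsupport_lap_subset)

lemma lap_contDiffOn {U : Set (EuclideanSpace ℝ (Fin n))} (hU : IsOpen U) {k : ℕ}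
    (hf : ContDiffOn ℝ (k + 2) f U) : ContDiffOn ℝ k (lap f) U := by
  have h : ContDiffOn ℝ k (fun x => ∑ i, pd i (pd i f) x) U := by
    refine ContDiffOn.sum fun i _ => pd_contDiffOn hU i ?_
    have := pd_contDiffOn (k := k + 1) hU i (f := f) (by convert hf using 1; push_cast; ring)
    exact_mod_cast this
  refine h.congr fun x hx => lap_eq_sum_pd_of_contDiffAt ?_
  exact (hf.of_le (by simp)).contDiffAt (hU.mem_nhds hx)

lemma pd_mul (i : Fin n) (hf : ContDiff ℝ (⊤ : ℕ∞) f) (hg : ContDiff ℝ (⊤ : ℕ∞) g) :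
    pd i (fun x => f x * g x) = fun x => pd i f x * g x + f x * pd i g x := by
  funext x
  unfold pd
  rw [fderiv_fun_mul (hf.differentiable (by simp) x) (hg.differentiable (by simp) x)]
  simp
  ring

lemma pd_add (i : Fin n) (hf : ContDiff ℝ (⊤ : ℕ∞) f) (hg : ContDiff ℝ (⊤ : ℕ∞) g) :
    pd i (fun x => f x + g x) = fun x => pd i f x + pd i g x := by
  funext x
  unfold pd
  rw [fderiv_fun_add (hf.differentiable (by simp) x) (hg.differentiable (by simp) x)]
  simp

lemma pd_const_mul (i : Fin n) (c : ℝ) (hf : ContDiff ℝ (⊤ : ℕ∞) f) :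
    pd i (fun x => c * f x) = fun x => c * pd i f x := by
  funext x
  unfold pd
  rw [fderiv_const_mul (hf.differentiable (by simp) x)]
  simp

lemma pd_comp_dilation (i : Fin n) (c : ℝ) (a : EuclideanSpace ℝ (Fin n))
    (hf : ContDiff ℝ (⊤ : ℕ∞) f) :
    pd i (fun x => f (c • (x - a))) = fun x => c * pd i f (c • (x - a)) := by
  funext x
  have h1 : HasFDerivAt (fun x : EuclideanSpace ℝ (Fin n) => c • (x - a))
      (c • ContinuousLinearMap.id ℝ _) x := ((hasFDerivAt_id x).sub_const a).const_smul c
  have h2 := ((hf.differentiable (by simp) (c • (x - a))).hasFDerivAt).comp x h1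
  unfold pd
  have h3 : fderiv ℝ (fun x => f (c • (x - a))) x = _ := h2.fderiv
  rw [h3]
  simp

lemma contDiff_comp_dilation (c : ℝ) (a : EuclideanSpace ℝ (Fin n))
    (hf : ContDiff ℝ (⊤ : ℕ∞) f) : ContDiff ℝ (⊤ : ℕ∞) (fun x => f (c • (x - a))) :=
  hf.comp (by fun_prop)

lemma lap_comp_dilation (c : ℝ) (a : EuclideanSpace ℝ (Fin n))
    (hf : ContDiff ℝ (⊤ : ℕ∞) f) :
    lap (fun x => f (c • (x - a))) = fun x => c ^ 2 * lap f (c • (x - a)) := by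
  rw [lap_eq_sum_pd (contDiff_comp_dilation c a hf), lap_eq_sum_pd hf]
  funext x
  rw [Finset.mul_sum]
  refine Finset.sum_congr rfl fun i _ => ?_
  rw [pd_comp_dilation i c a hf,
    pd_const_mul i c (contDiff_comp_dilation c a (pd_contDiff i hf)),
    pd_comp_dilation i c a (pd_contDiff i hf)]
  ring

lemma lap_const_mul (c : ℝ) (hf : ContDiff ℝ (⊤ : ℕ∞) f) :
    lap (fun x => c * f x) = fun x => c * lap f x := by
  rw [lap_eq_sum_pd (contDiff_const.mul hf), lap_eq_sum_pd hf]
  funext x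
  rw [Finset.mul_sum]
  refine Finset.sum_congr rfl fun i _ => ?_
  rw [pd_const_mul i c hf, pd_const_mul i c (pd_contDiff i hf)]

lemma lap_add (hf : ContDiff ℝ (⊤ : ℕ∞) f) (hg : ContDiff ℝ (⊤ : ℕ∞) g) :
    lap (fun x => f x + g x) = fun x => lap f x + lap g x := by
  rw [lap_eq_sum_pd (hf.add hg), lap_eq_sum_pd hf, lap_eq_sum_pd hg]
  funext x
  rw [← Finset.sum_add_distrib]
  refine Finset.sum_congr rfl fun i _ => ?_
  rw [pd_add i hf hg, pd_add i (pd_contDiff i hf) (pd_contDiff i hg)]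

lemma exists_bound_of_contDiff (hf : ContDiff ℝ (⊤ : ℕ∞) f) (hc : HasCompactSupport f) :
    ∃ C, 0 ≤ C ∧ ∀ x, |f x| ≤ C := by
  obtain ⟨C, hC⟩ := hc.exists_bound_of_continuous hf.continuous
  exact ⟨C, (norm_nonneg _).trans (hC 0), hC⟩

lemma continuous_mul_of_tsupport_subset {U : Set (EuclideanSpace ℝ (Fin n))} (hU : IsOpen U)
    (hf : ContinuousOn f U) (hg : Continuous g) (hgU : tsupport g ⊆ U) :
    Continuous fun x => f x * g x := by
  refine continuous_of_tsupport fun x hx => ?_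
  have hx' : x ∈ U := hgU (tsupport_mul_subset_right hx)
  exact (hf.continuousAt (hU.mem_nhds hx')).mul hg.continuousAt

lemma integrable_mul_of_tsupport_subset {U : Set (EuclideanSpace ℝ (Fin n))} (hU : IsOpen U)
    (hf : ContinuousOn f U) (hg : Continuous g) (hc : HasCompactSupport g)
    (hgU : tsupport g ⊆ U) : Integrable fun x => f x * g x :=
  (continuous_mul_of_tsupport_subset hU hf hg hgU).integrable_of_hasCompactSupport hc.mul_left

lemma integral_mul_pd {U : Set (EuclideanSpace ℝ (Fin n))} (hU : IsOpen U) (i : Fin n)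
    (hf : ContDiffOn ℝ 1 f U) (hg : ContDiff ℝ (⊤ : ℕ∞) g) (hc : HasCompactSupport g)
    (hgU : tsupport g ⊆ U) : ∫ x, f x * pd i g x = -∫ x, pd i f x * g x := by
  refine integral_mul_fderiv_eq_neg_fderiv_mul_of_integrable ?_ ?_ ?_ ?_ ?_
  · exact integrable_mul_of_tsupport_subset hU
      (pd_contDiffOn (k := 0) hU i (by simpa using hf)).continuousOn hg.continuous hc hgU
  · exact integrable_mul_of_tsupport_subset hU hf.continuousOn (pd_contDiff i hg).continuous
      (pd_hasCompactSupport i hc) ((tsupport_pd_subset i).trans hgU)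
  · exact integrable_mul_of_tsupport_subset hU hf.continuousOn hg.continuous hc hgU
  · exact fun x hx => (hf.contDiffAt (hU.mem_nhds (hgU hx))).differentiableAt (by norm_num)
  · exact fun x _ => hg.differentiable (by simp) x

/-- Green's identity against test functions supported in `U`. -/
lemma integral_mul_lap {U : Set (EuclideanSpace ℝ (Fin n))} (hU : IsOpen U)
    (hf : ContDiffOn ℝ 2 f U) (hg : ContDiff ℝ (⊤ : ℕ∞) g) (hc : HasCompactSupport g)
    (hgU : tsupport g ⊆ U) : ∫ x, f x * lap g x = ∫ x, lap f x * g x := by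
  have hpd : ∀ i, ContDiffOn ℝ 1 (pd i f) U := fun i => by
    simpa using pd_contDiffOn (k := 1) hU i (f := f) (by norm_num; exact hf)
  have e1 : ∀ x, f x * lap g x = ∑ i, f x * pd i (pd i g) x := fun x => by
    rw [lap_eq_sum_pd hg, Finset.mul_sum]
  have e2 : ∀ x, lap f x * g x = ∑ i, pd i (pd i f) x * g x := fun x => by
    by_cases hx : x ∈ tsupport g
    · rw [lap_eq_sum_pd_of_contDiffAt (hf.contDiffAt (hU.mem_nhds (hgU hx))), Finset.sum_mul]
    · simp [image_eq_zero_of_notMem_tsupport hx]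
  simp_rw [e1, e2]
  rw [integral_finsetSum, integral_finsetSum]
  · refine Finset.sum_congr rfl fun i _ => ?_
    rw [integral_mul_pd hU i (hf.of_le (by norm_num)) (pd_contDiff i hg)
      (pd_hasCompactSupport i hc) ((tsupport_pd_subset i).trans hgU),
      integral_mul_pd hU i (hpd i) hg hc hgU, neg_neg]
  · exact fun i _ => integrable_mul_of_tsupport_subset hU
      (pd_contDiffOn (k := 0) hU i (by simpa using hpd i)).continuousOn hg.continuous hc hgU
  · exact fun i _ => integrable_mul_of_tsupport_subset hU hf.continuousOn
      (pd_contDiff i (pd_contDiff i hg)).continuous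
      (pd_hasCompactSupport i (pd_hasCompactSupport i hc))
      (((tsupport_pd_subset i).trans (tsupport_pd_subset i)).trans hgU)

end Calculus

section TestFunctions

variable {n : ℕ}

lemma exists_pd_pow_mul (i : Fin n) (k : ℕ) {f g : EuclideanSpace ℝ (Fin n) → ℝ}
    (hf : ContDiff ℝ (⊤ : ℕ∞) f) (hg : ContDiff ℝ (⊤ : ℕ∞) g) :
    ∃ h, ContDiff ℝ (⊤ : ℕ∞) h ∧
      pd i (fun x => f x ^ (k + 1) * g x) = fun x => f x ^ k * h x := by
  refine ⟨fun x => ((k + 1 : ℕ) : ℝ) * pd i f x * g x + f x * pd i g x,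
    ((contDiff_const.mul (pd_contDiff i hf)).mul hg).add (hf.mul (pd_contDiff i hg)), ?_⟩
  rw [pd_mul i (hf.pow _) hg]
  funext x
  have h1 : pd i (fun x => f x ^ (k + 1)) x = ((k + 1 : ℕ) : ℝ) * f x ^ k * pd i f x := by
    unfold pd
    have := (hf.differentiable (by simp) x).hasFDerivAt.pow (k + 1)
    rw [HasFDerivAt.fderiv this]
    simp
  rw [h1]
  ring

lemma exists_lap_pow_mul (k : ℕ) {f g : EuclideanSpace ℝ (Fin n) → ℝ}
    (hf : ContDiff ℝ (⊤ : ℕ∞) f) (hg : ContDiff ℝ (⊤ : ℕ∞) g) :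
    ∃ h, ContDiff ℝ (⊤ : ℕ∞) h ∧
      lap (fun x => f x ^ (k + 2) * g x) = fun x => f x ^ k * h x := by
  choose h₁ hh₁ e₁ using fun i : Fin n => exists_pd_pow_mul i (k + 1) hf hg
  choose h₂ hh₂ e₂ using fun i : Fin n => exists_pd_pow_mul i k hf (hh₁ i)
  refine ⟨fun x => ∑ i, h₂ i x, ContDiff.sum fun i _ => hh₂ i, ?_⟩
  rw [lap_eq_sum_pd ((hf.pow _).mul hg)]
  funext x
  rw [Finset.mul_sum]
  refine Finset.sum_congr rfl fun i _ => ?_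
  rw [e₁, e₂]

lemma exists_bilap_pow (k : ℕ) {f : EuclideanSpace ℝ (Fin n) → ℝ}
    (hf : ContDiff ℝ (⊤ : ℕ∞) f) (hf0 : ∀ x, 0 ≤ f x) (hc : HasCompactSupport f) :
    ∃ C, 0 < C ∧ ∀ x, |bilap (fun x => f x ^ (k + 4)) x| ≤ C * f x ^ k := by
  obtain ⟨h₁, hh₁, e₁⟩ := exists_lap_pow_mul (k + 2) hf (contDiff_const (c := (1 : ℝ)))
  obtain ⟨h₂, hh₂, e₂⟩ := exists_lap_pow_mul k hf hh₁
  obtain ⟨C, hC⟩ := hc.isCompact.exists_bound_of_continuousOn hh₂.continuous.continuousOn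
  simp only [mul_one] at e₁
  refine ⟨|C| + 1, by positivity, fun x => ?_⟩
  have hb : bilap (fun x => f x ^ (k + 4)) = fun x => f x ^ k * h₂ x := by
    unfold bilap
    rw [e₁, e₂]
  by_cases hx : x ∈ tsupport f
  · rw [hb]
    simp only
    rw [abs_mul, abs_of_nonneg (pow_nonneg (hf0 x) k), mul_comm]
    refine mul_le_mul_of_nonneg_right ?_ (pow_nonneg (hf0 x) k)
    have := hC x hx
    rw [Real.norm_eq_abs] at this
    linarith [le_abs_self C]
  · have : bilap (fun x => f x ^ (k + 4)) x = 0 := by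
      refine image_eq_zero_of_notMem_tsupport fun h => hx ?_
      have h' := tsupport_lap_subset (tsupport_lap_subset h)
      refine closure_mono (fun y (hy : f y ^ (k + 4) ≠ 0) (h0 : f y = 0) => hy ?_) h'
      simp [h0]
    rw [this, abs_zero]
    have := pow_nonneg (hf0 x) k
    positivity

lemma exists_annular_cutoff : ∃ η : EuclideanSpace ℝ (Fin n) → ℝ, ContDiff ℝ (⊤ : ℕ∞) η ∧
    (∀ x, 0 ≤ η x) ∧ (∀ x, η x ≤ 1) ∧ (∀ x, 1 ≤ ‖x‖ → ‖x‖ ≤ 2 → η x = 1) ∧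
    (∀ x, ‖x‖ < 1 / 2 → η x = 0) ∧ ∀ x, 3 ≤ ‖x‖ → η x = 0 := by
  let b₁ : ContDiffBump (0 : EuclideanSpace ℝ (Fin n)) := ⟨2, 3, by norm_num, by norm_num⟩
  let b₂ : ContDiffBump (0 : EuclideanSpace ℝ (Fin n)) := ⟨1 / 2, 1, by norm_num, by norm_num⟩
  refine ⟨fun x => b₁ x * (1 - b₂ x), b₁.contDiff.mul (contDiff_const.sub b₂.contDiff),
    fun x => mul_nonneg b₁.nonneg (sub_nonneg.2 b₂.le_one),
    fun x => mul_le_one₀ b₁.le_one (sub_nonneg.2 b₂.le_one) (sub_le_self _ b₂.nonneg),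
    fun x h1 h2 => ?_, fun x h => ?_, fun x h => ?_⟩
  · beta_reduce
    rw [b₁.one_of_mem_closedBall (by simpa [b₁] using h2),
      b₂.zero_of_le_dist (by simpa [b₂] using h1)]
    simp
  · beta_reduce
    rw [b₂.one_of_mem_closedBall (by simpa [b₂] using h.le)]
    simp
  · beta_reduce
    rw [b₁.zero_of_le_dist (by simpa [b₁] using h)]
    simp

/-- Families `F l` built from products `ξ(l x) φ(x)` of a dilated and a fixed function, with at
most `k` powers of `l` lost. -/
inductive DilationFamily : ℕ → (ℝ → EuclideanSpace ℝ (Fin n) → ℝ) → Prop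
  | base (ξ φ : EuclideanSpace ℝ (Fin n) → ℝ) (hξ : ContDiff ℝ (⊤ : ℕ∞) ξ)
      (hξc : HasCompactSupport ξ) (hφ : ContDiff ℝ (⊤ : ℕ∞) φ) (hφc : HasCompactSupport φ) :
      DilationFamily 0 (fun l x => ξ (l • (x - 0)) * φ x)
  | add (k : ℕ) (F G : ℝ → EuclideanSpace ℝ (Fin n) → ℝ) (hF : DilationFamily k F)
      (hG : DilationFamily k G) : DilationFamily k (fun l x => F l x + G l x)
  | mul (k : ℕ) (F : ℝ → EuclideanSpace ℝ (Fin n) → ℝ) (hF : DilationFamily k F) :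
      DilationFamily (k + 1) (fun l x => l * F l x)
  | succ (k : ℕ) (F : ℝ → EuclideanSpace ℝ (Fin n) → ℝ) (hF : DilationFamily k F) :
      DilationFamily (k + 1) F

lemma DilationFamily.zero (k : ℕ) : DilationFamily (n := n) k (fun _ _ => 0) := by
  induction k with
  | zero =>
    have := DilationFamily.base (n := n) (fun _ => 0) (fun _ => 0) contDiff_const
      HasCompactSupport.zero contDiff_const HasCompactSupport.zero
    simpa using this
  | succ k ih => exact .succ _ _ ih

lemma DilationFamily.sum {k : ℕ} {ι : Type*} (s : Finset ι)
    {F : ι → ℝ → EuclideanSpace ℝ (Fin n) → ℝ} (hF : ∀ i, DilationFamily k (F i)) :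
    DilationFamily k (fun l x => ∑ i ∈ s, F i l x) := by
  classical
  induction s using Finset.induction_on with
  | empty => simpa using DilationFamily.zero k
  | insert a s ha ih =>
    simp_rw [Finset.sum_insert ha]
    exact .add _ _ _ (hF a) ih

lemma DilationFamily.contDiff {k : ℕ} {F : ℝ → EuclideanSpace ℝ (Fin n) → ℝ}
    (hF : DilationFamily k F) (l : ℝ) : ContDiff ℝ (⊤ : ℕ∞) (F l) := by
  induction hF with
  | base ξ φ hξ hξc hφ hφc => exact (contDiff_comp_dilation l 0 hξ).mul hφ
  | add k F G hF hG ihF ihG => exact ihF.add ihG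
  | mul k F hF ih => exact contDiff_const.mul ih
  | succ k F hF ih => exact ih

lemma DilationFamily.exists_bound {k : ℕ} {F : ℝ → EuclideanSpace ℝ (Fin n) → ℝ}
    (hF : DilationFamily k F) : ∃ C, 0 ≤ C ∧ ∀ l, 1 ≤ l → ∀ x, |F l x| ≤ C * l ^ k := by
  induction hF with
  | base ξ φ hξ hξc hφ hφc =>
    obtain ⟨A, hA0, hA⟩ := exists_bound_of_contDiff hξ hξc
    obtain ⟨B, hB0, hB⟩ := exists_bound_of_contDiff hφ hφc
    refine ⟨A * B, by positivity, fun l _ x => ?_⟩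
    rw [abs_mul, pow_zero, mul_one]
    exact mul_le_mul (hA _) (hB _) (abs_nonneg _) hA0
  | add k F G hF hG ihF ihG =>
    obtain ⟨A, hA0, hA⟩ := ihF
    obtain ⟨B, hB0, hB⟩ := ihG
    refine ⟨A + B, by positivity, fun l hl x => (abs_add_le _ _).trans ?_⟩
    rw [add_mul]
    exact add_le_add (hA l hl x) (hB l hl x)
  | mul k F hF ih =>
    obtain ⟨A, hA0, hA⟩ := ih
    refine ⟨A, hA0, fun l hl x => ?_⟩
    rw [abs_mul, abs_of_pos (by linarith), pow_succ, ← mul_assoc, mul_comm]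
    exact mul_le_mul_of_nonneg_right (hA l hl x) (by linarith)
  | succ k F hF ih =>
    obtain ⟨A, hA0, hA⟩ := ih
    refine ⟨A, hA0, fun l hl x => (hA l hl x).trans ?_⟩
    exact mul_le_mul_of_nonneg_left (pow_le_pow_right₀ hl (Nat.le_succ k)) hA0

lemma DilationFamily.pd {k : ℕ} {F : ℝ → EuclideanSpace ℝ (Fin n) → ℝ}
    (hF : DilationFamily k F) (i : Fin n) :
    DilationFamily (k + 1) (fun l => _root_.pd i (F l)) := by
  induction hF with
  | base ξ φ hξ hξc hφ hφc =>
    have h1 := DilationFamily.base _ φ (pd_contDiff i hξ) (pd_hasCompactSupport i hξc) hφ hφc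
    have h2 := DilationFamily.base ξ _ hξ hξc (pd_contDiff i hφ) (pd_hasCompactSupport i hφc)
    convert DilationFamily.add _ _ _ (.mul _ _ h1) (.succ _ _ h2) using 2 with l
    rw [pd_mul i (contDiff_comp_dilation l 0 hξ) hφ, pd_comp_dilation i l 0 hξ]
    simp only [mul_assoc]
  | add k F G hF hG ihF ihG =>
    convert DilationFamily.add _ _ _ ihF ihG using 2 with l
    exact pd_add i (hF.contDiff l) (hG.contDiff l)
  | mul k F hF ih =>
    convert DilationFamily.mul _ _ ih using 2 with l
    exact pd_const_mul i l (hF.contDiff l)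
  | succ k F hF ih => exact .succ _ _ ih

lemma DilationFamily.lap {k : ℕ} {F : ℝ → EuclideanSpace ℝ (Fin n) → ℝ}
    (hF : DilationFamily k F) : DilationFamily (k + 2) (fun l => _root_.lap (F l)) := by
  convert DilationFamily.sum Finset.univ (fun i : Fin n => (hF.pd i).pd i) using 2 with l
  exact lap_eq_sum_pd (hF.contDiff l)

lemma DilationFamily.lap_iterate {F : ℝ → EuclideanSpace ℝ (Fin n) → ℝ}
    (hF : DilationFamily 0 F) (m : ℕ) :
    DilationFamily (2 * m) (fun l => _root_.lap^[m] (F l)) := by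
  induction m with
  | zero => exact hF
  | succ m ih =>
    simp_rw [Function.iterate_succ_apply']
    exact ih.lap

end TestFunctions

section Estimates

variable {n : ℕ}

lemma lintegral_closedBall_le_of_annuli (hn : 0 < n) {G : EuclideanSpace ℝ (Fin n) → ENNReal}
    {C β : ℝ} (hC : 0 ≤ C) (hβ : 0 < β)
    (h : ∀ r, 0 < r → ∫⁻ x in {x | r ≤ ‖x‖ ∧ ‖x‖ ≤ 2 * r}, G x ≤ ENNReal.ofReal (C * r ^ β)) :
    ∃ C', 0 ≤ C' ∧ ∀ r, 0 < r →
      ∫⁻ x in closedBall 0 r, G x ≤ ENNReal.ofReal (C' * r ^ β) := by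
  have : Nonempty (Fin n) := ⟨⟨0, hn⟩⟩
  set q : ℝ := (1 / 2 : ℝ) ^ β with hq
  have hq0 : 0 ≤ q := by positivity
  have hq1 : q < 1 := Real.rpow_lt_one (by norm_num) (by norm_num) hβ
  have hsum : Summable fun k : ℕ => q ^ (k + 1) :=
    (summable_geometric_of_lt_one hq0 hq1).comp_injective (add_left_injective 1)
  refine ⟨C * ∑' k : ℕ, q ^ (k + 1), mul_nonneg hC (tsum_nonneg fun k => by positivity),
    fun r hr => ?_⟩
  have hcover : closedBall (0 : EuclideanSpace ℝ (Fin n)) r \ {0} ⊆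
      ⋃ k : ℕ, {x | r * (1 / 2) ^ (k + 1) ≤ ‖x‖ ∧ ‖x‖ ≤ 2 * (r * (1 / 2) ^ (k + 1))} := by
    rintro x ⟨hx, hx0⟩
    have hxr : ‖x‖ ≤ r := by simpa using hx
    have hxp : 0 < ‖x‖ := norm_pos_iff.2 hx0
    obtain ⟨k, hk1, hk2⟩ := exists_nat_pow_near_of_lt_one (x := ‖x‖ / r) (y := (1 / 2 : ℝ))
      (by positivity) ((div_le_one hr).2 hxr) (by norm_num) (by norm_num)
    rw [Set.mem_iUnion]
    refine ⟨k, ?_, ?_⟩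
    · have := (lt_div_iff₀ hr).1 hk1
      linarith
    · have := (div_le_iff₀ hr).1 hk2
      rw [pow_succ]
      linarith
  have hball : ∫⁻ x in closedBall 0 r, G x = ∫⁻ x in closedBall 0 r \ {0}, G x :=
    (setLIntegral_congr (sdiff_null_ae_eq_self (measure_singleton _))).symm
  rw [hball]
  calc ∫⁻ x in closedBall 0 r \ {0}, G x
      ≤ ∑' k : ℕ, ∫⁻ x in {x | r * (1 / 2) ^ (k + 1) ≤ ‖x‖ ∧
          ‖x‖ ≤ 2 * (r * (1 / 2) ^ (k + 1))}, G x :=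
        (lintegral_mono_set hcover).trans (lintegral_iUnion_le _ _)
    _ ≤ ∑' k : ℕ, ENNReal.ofReal (C * r ^ β * q ^ (k + 1)) := by
        refine ENNReal.tsum_le_tsum fun k => (h _ (by positivity)).trans_eq ?_
        rw [Real.mul_rpow hr.le (by positivity), hq, ← Real.rpow_natCast, ← Real.rpow_natCast,
          ← Real.rpow_mul (by norm_num), ← Real.rpow_mul (by norm_num), mul_comm β, mul_assoc]
    _ = ENNReal.ofReal (∑' k : ℕ, C * r ^ β * q ^ (k + 1)) :=
        (ENNReal.ofReal_tsum_of_nonneg (fun k => by positivity) (hsum.mul_left _)).symm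
    _ = ENNReal.ofReal (C * (∑' k : ℕ, q ^ (k + 1)) * r ^ β) := by
        rw [tsum_mul_left]
        ring_nf

lemma integrable_mul_and_abs_integral_le {a ψ : EuclideanSpace ℝ (Fin n) → ℝ} {r K M : ℝ}
    (ha : AEStronglyMeasurable a) (hK : 0 ≤ K) (hM : 0 ≤ M)
    (haK : ∫⁻ x in closedBall 0 r, ‖a x‖ₑ ≤ ENNReal.ofReal K) (hψ : Continuous ψ)
    (hψM : ∀ x, |ψ x| ≤ M) (hψ0 : ∀ x, r < ‖x‖ → ψ x = 0) :
    (Integrable fun x => a x * ψ x) ∧ |∫ x, a x * ψ x| ≤ M * K := by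
  have hle : ∫⁻ x, ‖a x * ψ x‖ₑ ≤ ENNReal.ofReal (M * K) := by
    calc ∫⁻ x, ‖a x * ψ x‖ₑ ≤ ∫⁻ x, (closedBall 0 r).indicator
          (fun x => ENNReal.ofReal M * ‖a x‖ₑ) x := by
          refine lintegral_mono fun x => ?_
          by_cases hx : x ∈ closedBall (0 : EuclideanSpace ℝ (Fin n)) r
          · rw [Set.indicator_of_mem hx, enorm_mul, mul_comm]
            gcongr
            rw [Real.enorm_eq_ofReal_abs]
            exact ENNReal.ofReal_le_ofReal (hψM x)
          · rw [hψ0 x (by simpa using hx)]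
            simp
      _ = ENNReal.ofReal M * ∫⁻ x in closedBall 0 r, ‖a x‖ₑ := by
          rw [lintegral_indicator measurableSet_closedBall,
            lintegral_const_mul' _ _ ENNReal.ofReal_ne_top]
      _ ≤ ENNReal.ofReal (M * K) := by
          rw [ENNReal.ofReal_mul hM]
          gcongr
  refine ⟨⟨ha.mul hψ.aestronglyMeasurable, hle.trans_lt ENNReal.ofReal_lt_top⟩, ?_⟩
  have := (enorm_integral_le_lintegral_enorm _).trans hle
  rw [Real.enorm_eq_ofReal_abs] at this
  exact (ENNReal.ofReal_le_ofReal_iff (by positivity)).1 this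

lemma lap_iterate_contDiff (m : ℕ) {f : EuclideanSpace ℝ (Fin n) → ℝ}
    (hf : ContDiff ℝ (⊤ : ℕ∞) f) : ContDiff ℝ (⊤ : ℕ∞) (lap^[m] f) := by
  induction m with
  | zero => exact hf
  | succ m ih =>
    rw [Function.iterate_succ_apply']
    exact lap_contDiff ih

lemma tsupport_lap_iterate_subset (m : ℕ) {f : EuclideanSpace ℝ (Fin n) → ℝ} :
    tsupport (lap^[m] f) ⊆ tsupport f := by
  induction m with
  | zero => exact subset_rfl
  | succ m ih =>
    rw [Function.iterate_succ_apply']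
    exact tsupport_lap_subset.trans ih

lemma lap_iterate_add (m : ℕ) {f g : EuclideanSpace ℝ (Fin n) → ℝ}
    (hf : ContDiff ℝ (⊤ : ℕ∞) f) (hg : ContDiff ℝ (⊤ : ℕ∞) g) :
    lap^[m] (fun x => f x + g x) = fun x => lap^[m] f x + lap^[m] g x := by
  induction m with
  | zero => rfl
  | succ m ih =>
    simp_rw [Function.iterate_succ_apply']
    rw [ih, lap_add (lap_iterate_contDiff m hf) (lap_iterate_contDiff m hg)]

/-- A distributional identity `Δᵐ a = b` off the origin extends across the origin when `a` and `b`
have enough decay in mean there. -/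
lemma integral_mul_lap_iterate_of_removable (m : ℕ) {α A B : ℝ} (hα : 0 < α)
    (hA : 0 ≤ A) (hB : 0 ≤ B) {a b : EuclideanSpace ℝ (Fin n) → ℝ}
    (ha : AEStronglyMeasurable a) (hb : AEStronglyMeasurable b)
    (haA : ∀ r, 0 < r → ∫⁻ x in closedBall 0 r, ‖a x‖ₑ ≤ ENNReal.ofReal (A * r ^ (α + 2 * m)))
    (hbB : ∀ r, 0 < r → ∫⁻ x in closedBall 0 r, ‖b x‖ₑ ≤ ENNReal.ofReal (B * r ^ α))
    (h : ∀ φ : EuclideanSpace ℝ (Fin n) → ℝ, ContDiff ℝ (⊤ : ℕ∞) φ → HasCompactSupport φ →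
      tsupport φ ⊆ {0}ᶜ → ∫ x, a x * lap^[m] φ x = ∫ x, b x * φ x)
    {φ : EuclideanSpace ℝ (Fin n) → ℝ} (hφ : ContDiff ℝ (⊤ : ℕ∞) φ) (hφc : HasCompactSupport φ) :
    ∫ x, a x * lap^[m] φ x = ∫ x, b x * φ x := by
  let ξ : ContDiffBump (0 : EuclideanSpace ℝ (Fin n)) := ⟨1, 2, by norm_num, by norm_num⟩
  have hint : ∀ c : EuclideanSpace ℝ (Fin n) → ℝ, AEStronglyMeasurable c → ∀ β D : ℝ, 0 ≤ D →
      (∀ r, 0 < r → ∫⁻ x in closedBall 0 r, ‖c x‖ₑ ≤ ENNReal.ofReal (D * r ^ β)) →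
      ∀ ψ : EuclideanSpace ℝ (Fin n) → ℝ, Continuous ψ → HasCompactSupport ψ →
      Integrable fun x => c x * ψ x := by
    intro c hc β D hD hcD ψ hψ hψc
    obtain ⟨r, hr, hsub⟩ := hψc.isCompact.isBounded.subset_closedBall_lt 0 0
    obtain ⟨M, hM⟩ := hψc.exists_bound_of_continuous hψ
    refine (integrable_mul_and_abs_integral_le hc (K := D * r ^ β) (by positivity)
      ((norm_nonneg _).trans (hM 0)) (hcD r hr) hψ hM fun x hx => ?_).1
    refine image_eq_zero_of_notMem_tsupport fun hx' => ?_
    have := hsub hx'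
    simp only [mem_closedBall, dist_zero_right] at this
    linarith
  set F : ℝ → EuclideanSpace ℝ (Fin n) → ℝ := fun l x => ξ (l • (x - 0)) * φ x with hF
  have hFam : DilationFamily 0 F := .base _ φ ξ.contDiff ξ.hasCompactSupport hφ hφc
  have hFs : ∀ l, ContDiff ℝ (⊤ : ℕ∞) (F l) := hFam.contDiff
  have hFc : ∀ l, HasCompactSupport (F l) := fun l => hφc.mul_left
  have hF0 : ∀ l, 0 < l → ∀ x ∈ tsupport (F l), ‖x‖ ≤ 2 / l := by
    intro l hl
    have hcl : IsClosed {x : EuclideanSpace ℝ (Fin n) | ‖x‖ ≤ 2 / l} :=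
      isClosed_le continuous_norm continuous_const
    refine closure_minimal (fun x hx => ?_) hcl
    by_contra hlt
    replace hlt : 2 / l < ‖x‖ := not_le.1 hlt
    refine hx ?_
    have : ξ (l • (x - 0)) = 0 := ξ.zero_of_le_dist (by
      have := (div_lt_iff₀ hl).1 hlt
      simp only [sub_zero, dist_zero_right, norm_smul, Real.norm_eq_abs, abs_of_pos hl, ξ]
      linarith)
    change ξ (l • (x - 0)) * φ x = 0
    rw [this, zero_mul]
  obtain ⟨C₁, hC₁0, hC₁⟩ := hFam.exists_bound
  obtain ⟨C₂, hC₂0, hC₂⟩ := (hFam.lap_iterate m).exists_bound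
  set T : (EuclideanSpace ℝ (Fin n) → ℝ) → ℝ :=
    fun ψ => ∫ x, a x * lap^[m] ψ x - b x * ψ x with hT
  have hTint : ∀ ψ, ContDiff ℝ (⊤ : ℕ∞) ψ → HasCompactSupport ψ →
      (Integrable fun x => a x * lap^[m] ψ x) ∧ Integrable fun x => b x * ψ x :=
    fun ψ hψ hψc => ⟨hint a ha _ A hA haA _ (lap_iterate_contDiff m hψ).continuous
      (hψc.mono' (subset_closure.trans (tsupport_lap_iterate_subset m))),
      hint b hb _ B hB hbB ψ hψ.continuous hψc⟩
  have hTφ : ∀ l, 1 ≤ l → T φ = T (F l) := by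
    intro l hl
    have hl0 : 0 < l := by linarith
    set G : EuclideanSpace ℝ (Fin n) → ℝ := fun x => φ x + (-1) * F l x with hG
    have hGs : ContDiff ℝ (⊤ : ℕ∞) G := hφ.add (contDiff_const.mul (hFs l))
    have hGc : HasCompactSupport G := hφc.add (hFc l).mul_left
    have hG0 : tsupport G ⊆ {0}ᶜ := by
      intro x hx hx0
      rw [Set.mem_singleton_iff] at hx0
      subst hx0
      refine (notMem_tsupport_iff_eventuallyEq.2 ?_) hx
      filter_upwards [ball_mem_nhds (0 : EuclideanSpace ℝ (Fin n)) (inv_pos.2 hl0)] with x hx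
      have : ξ (l • (x - 0)) = 1 := ξ.one_of_mem_closedBall (by
        have hx' : ‖x‖ < l⁻¹ := by simpa using hx
        have := (lt_inv_mul_iff₀ hl0).1 (by simpa using hx' : ‖x‖ < l⁻¹ * 1)
        simp only [sub_zero, mem_closedBall, dist_zero_right, norm_smul, Real.norm_eq_abs,
          abs_of_pos hl0, ξ]
        linarith)
      change φ x + (-1) * (ξ (l • (x - 0)) * φ x) = 0
      rw [this]
      ring
    have hsplit : φ = fun x => G x + F l x := by
      funext x
      simp only [hG]
      ring
    have hlap : lap^[m] φ = fun x => lap^[m] G x + lap^[m] (F l) x := by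
      conv_lhs => rw [hsplit]
      exact lap_iterate_add m hGs (hFs l)
    obtain ⟨i1, i2⟩ := hTint G hGs hGc
    obtain ⟨i3, i4⟩ := hTint (F l) (hFs l) (hFc l)
    have hTG : T G = 0 := by
      simp only [hT]
      rw [integral_sub i1 i2, h G hGs hGc hG0, sub_self]
    calc T φ = ∫ x, (a x * lap^[m] G x - b x * G x)
          + (a x * lap^[m] (F l) x - b x * F l x) := by
          simp only [hT]
          refine integral_congr_ae (Eventually.of_forall fun x => ?_)
          simp only [hlap]
          simp only [hG]
          ring
      _ = T G + T (F l) := integral_add (i1.sub i2) (i3.sub i4)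
      _ = T (F l) := by rw [hTG, zero_add]
  have hbound : ∀ l : ℝ, 1 ≤ l →
      |T φ| ≤ (C₂ * A * 2 ^ (α + 2 * m) + C₁ * B * 2 ^ α) * l ^ (-α) := by
    intro l hl
    have hl0 : 0 < l := by linarith
    obtain ⟨i3, i4⟩ := hTint (F l) (hFs l) (hFc l)
    have hz : ∀ x, 2 / l < ‖x‖ → x ∉ tsupport (F l) := fun x hx hx' =>
      (hF0 l hl0 x hx').not_gt hx
    have b1 := (integrable_mul_and_abs_integral_le ha (by positivity)
      (by positivity : 0 ≤ C₂ * l ^ (2 * m)) (haA (2 / l) (by positivity))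
      (lap_iterate_contDiff m (hFs l)).continuous (hC₂ l hl)
      (fun x hx => image_eq_zero_of_notMem_tsupport fun h' =>
        hz x hx (tsupport_lap_iterate_subset m h'))).2
    have b2 := (integrable_mul_and_abs_integral_le hb (by positivity)
      (by positivity : 0 ≤ C₁ * l ^ 0) (hbB (2 / l) (by positivity))
      (hFs l).continuous (hC₁ l hl)
      (fun x hx => image_eq_zero_of_notMem_tsupport (hz x hx))).2
    rw [hTφ l hl]
    simp only [hT]
    rw [integral_sub i3 i4]
    refine (abs_sub _ _).trans ((add_le_add b1 b2).trans_eq ?_)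
    rw [Real.div_rpow (by norm_num) hl0.le, Real.div_rpow (by norm_num) hl0.le,
      Real.rpow_add hl0, Real.rpow_neg hl0.le]
    have e : l ^ (2 * (m : ℝ)) = l ^ (2 * m) := by
      rw [← Real.rpow_natCast]
      push_cast
      rfl
    rw [e]
    have h1 : l ^ (2 * m) ≠ 0 := by positivity
    have h2 : l ^ α ≠ 0 := by positivity
    field_simp
  have hlim : Tendsto (fun l : ℝ => (C₂ * A * 2 ^ (α + 2 * m) + C₁ * B * 2 ^ α) * l ^ (-α))
      atTop (nhds 0) := by
    simpa using (tendsto_rpow_neg_atTop hα).const_mul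
      (C₂ * A * 2 ^ (α + 2 * m) + C₁ * B * 2 ^ α)
  have hT0 : |T φ| ≤ 0 :=
    ge_of_tendsto hlim ((eventually_ge_atTop 1).mono fun l hl => hbound l hl)
  have hT0' : T φ = 0 := abs_nonpos_iff.1 hT0
  obtain ⟨i1, i2⟩ := hTint φ hφ hφc
  simp only [hT] at hT0'
  rw [integral_sub i1 i2] at hT0'
  linarith

end Estimates

section Solutions

lemma mul_pow_le_half_rpow_mul_pow_add {p t a b : ℝ} {k : ℕ} (hp : 1 < p) (ht : 0 ≤ t)
    (ha0 : 0 ≤ a) (ha1 : a ≤ 1) (hb : 0 < b) (hk : 4 / (p - 1) ≤ k) :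
    b * t * a ^ k ≤ 1 / 2 * t ^ p * a ^ (k + 4) + b * (2 * b) ^ (1 / (p - 1)) := by
  have hp1 : 0 < p - 1 := by linarith
  have hs : 0 < 4 / (p - 1) := by positivity
  have hk0 : k ≠ 0 := by
    rintro rfl
    simp only [Nat.cast_zero] at hk
    linarith
  have hR : 0 ≤ b * (2 * b) ^ (1 / (p - 1)) := by positivity
  have hL : 0 ≤ 1 / 2 * t ^ p * a ^ (k + 4) := by positivity
  rcases ha0.eq_or_lt with rfl | ha
  · rw [zero_pow hk0, mul_zero]
    linarith
  rcases ht.eq_or_lt with rfl | ht'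
  · rw [mul_zero, zero_mul]
    linarith
  have htp : t ^ p = t ^ (p - 1) * t := by
    rw [Real.rpow_sub_one ht'.ne']
    field_simp
  rcases le_total (2 * b) (t ^ (p - 1) * a ^ 4) with h | h
  · have : b * t * a ^ k ≤ 1 / 2 * t ^ p * a ^ (k + 4) := by
      rw [htp, pow_add]
      have := mul_le_mul_of_nonneg_right h (by positivity : 0 ≤ t * a ^ k / 2)
      nlinarith
    linarith
  · have h1 : t * a ^ (4 / (p - 1)) ≤ (2 * b) ^ (1 / (p - 1)) := by
      have := Real.rpow_le_rpow (by positivity) h (by positivity : 0 ≤ 1 / (p - 1))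
      rw [Real.mul_rpow (by positivity) (by positivity), ← Real.rpow_mul ht,
        ← Real.rpow_natCast, ← Real.rpow_mul ha.le, mul_one_div_cancel hp1.ne',
        Real.rpow_one, mul_one_div] at this
      exact_mod_cast this
    have h2 : a ^ k ≤ a ^ (4 / (p - 1)) := by
      rw [← Real.rpow_natCast]
      exact Real.rpow_le_rpow_of_exponent_ge ha ha1 hk
    have h3 : t * a ^ k ≤ (2 * b) ^ (1 / (p - 1)) :=
      (mul_le_mul_of_nonneg_left h2 ht).trans h1
    have h4 := mul_le_mul_of_nonneg_left h3 hb.le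
    linarith

lemma le_pow_four_mul_rpow_add {p t r : ℝ} (hp : 1 < p) (ht : 0 ≤ t) (hr : 0 < r) :
    t ≤ r ^ 4 * t ^ p + r ^ (-(4 / (p - 1))) := by
  have hp1 : 0 < p - 1 := by linarith
  have h0 : 0 < r ^ (-(4 / (p - 1))) := by positivity
  rcases le_total t (r ^ (-(4 / (p - 1)))) with h | h
  · have : 0 ≤ r ^ 4 * t ^ p := by positivity
    linarith
  · have ht' : 0 < t := h0.trans_le h
    have h1 := Real.rpow_le_rpow h0.le h hp1.le
    rw [← Real.rpow_mul hr.le, neg_mul, div_mul_cancel₀ _ hp1.ne', Real.rpow_neg hr.le] at h1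
    have h2 : (1 : ℝ) ≤ r ^ 4 * t ^ (p - 1) := by
      rw [← inv_le_iff_one_le_mul₀' (by positivity)]
      exact_mod_cast h1
    have htp : t ^ p = t ^ (p - 1) * t := by
      rw [Real.rpow_sub_one ht'.ne']
      field_simp
    rw [htp]
    nlinarith

variable {n : ℕ}

lemma tsupport_subset_compl_singleton {f : EuclideanSpace ℝ (Fin n) → ℝ} {δ : ℝ} (hδ : 0 < δ)
    (hf : ∀ x, ‖x‖ < δ → f x = 0) : tsupport f ⊆ {0}ᶜ := by
  intro x hx hx0
  rw [Set.mem_singleton_iff] at hx0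
  subst hx0
  refine (notMem_tsupport_iff_eventuallyEq.2 ?_) hx
  filter_upwards [ball_mem_nhds (0 : EuclideanSpace ℝ (Fin n)) hδ] with x hx
  exact hf x (by simpa using hx)

lemma hasCompactSupport_of_norm_lt {f : EuclideanSpace ℝ (Fin n) → ℝ} {R : ℝ}
    (hf : ∀ x, R < ‖x‖ → f x = 0) : HasCompactSupport f :=
  HasCompactSupport.intro (isCompact_closedBall 0 R) fun x hx => hf x (by simpa using hx)

lemma measurableSet_annulus (r : ℝ) :
    MeasurableSet {x : EuclideanSpace ℝ (Fin n) | r ≤ ‖x‖ ∧ ‖x‖ ≤ 2 * r} :=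
  (measurableSet_le measurable_const measurable_norm).inter
    (measurableSet_le measurable_norm measurable_const)

lemma volume_closedBall_eq {r : ℝ} (hr : 0 ≤ r) :
    volume (closedBall (0 : EuclideanSpace ℝ (Fin n)) r) =
      ENNReal.ofReal (r ^ n * volume.real (ball (0 : EuclideanSpace ℝ (Fin n)) 1)) := by
  rw [Measure.addHaar_closedBall _ _ hr, ENNReal.ofReal_mul (by positivity), Measure.real,
    ENNReal.ofReal_toReal measure_ball_lt_top.ne]
  simp

lemma aestronglyMeasurable_of_continuousOn_compl (hn : 0 < n) {f : EuclideanSpace ℝ (Fin n) → ℝ}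
    (hf : ContinuousOn f {0}ᶜ) : AEStronglyMeasurable f := by
  have : Nonempty (Fin n) := ⟨⟨0, hn⟩⟩
  have h := hf.aestronglyMeasurable (μ := volume)
    (measurableSet_singleton (0 : EuclideanSpace ℝ (Fin n))).compl
  rwa [Measure.restrict_eq_self_of_ae_mem] at h
  exact compl_mem_ae_iff.2 (measure_singleton _)

lemma lintegral_annulus_le_of_integral {f ψ : EuclideanSpace ℝ (Fin n) → ℝ} {r K : ℝ}
    (hf : ∀ x, 0 ≤ f x * ψ x) (hi : Integrable fun x => f x * ψ x)
    (hψ : ∀ x, r ≤ ‖x‖ → ‖x‖ ≤ 2 * r → ψ x = 1) (hK : ∫ x, f x * ψ x ≤ K) :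
    ∫⁻ x in {x | r ≤ ‖x‖ ∧ ‖x‖ ≤ 2 * r}, ‖f x‖ₑ ≤ ENNReal.ofReal K := by
  calc ∫⁻ x in {x | r ≤ ‖x‖ ∧ ‖x‖ ≤ 2 * r}, ‖f x‖ₑ
      ≤ ∫⁻ x in {x | r ≤ ‖x‖ ∧ ‖x‖ ≤ 2 * r}, ENNReal.ofReal (f x * ψ x) := by
        refine setLIntegral_mono' (measurableSet_annulus r) fun x hx => ?_
        have h0 := hf x
        rw [hψ x hx.1 hx.2, mul_one] at h0 ⊢
        rw [Real.enorm_of_nonneg h0]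
    _ ≤ ∫⁻ x, ENNReal.ofReal (f x * ψ x) := setLIntegral_le_lintegral _ _
    _ = ENNReal.ofReal (∫ x, f x * ψ x) :=
        (ofReal_integral_eq_lintegral_ofReal hi (Eventually.of_forall hf)).symm
    _ ≤ ENNReal.ofReal K := ENNReal.ofReal_le_ofReal hK

lemma integral_mul_bilap_eq {p : ℝ} {u : EuclideanSpace ℝ (Fin n) → ℝ}
    (hreg : ContDiffOn ℝ 4 u {(0 : EuclideanSpace ℝ (Fin n))}ᶜ)
    (heq : ∀ x : EuclideanSpace ℝ (Fin n), x ≠ 0 → bilap u x = u x ^ p)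
    {φ : EuclideanSpace ℝ (Fin n) → ℝ} (hφ : ContDiff ℝ (⊤ : ℕ∞) φ) (hφc : HasCompactSupport φ)
    (hφ0 : tsupport φ ⊆ {0}ᶜ) :
    ∫ x, u x * bilap φ x = ∫ x, lap u x * lap φ x ∧
      ∫ x, lap u x * lap φ x = ∫ x, u x ^ p * φ x := by
  have hU : IsOpen ({0}ᶜ : Set (EuclideanSpace ℝ (Fin n))) := isOpen_compl_singleton
  have hlap : ContDiffOn ℝ 2 (lap u) {0}ᶜ :=
    lap_contDiffOn (k := 2) hU (by norm_num; exact hreg)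
  refine ⟨integral_mul_lap hU (hreg.of_le (by norm_num)) (lap_contDiff hφ)
    (lap_hasCompactSupport hφc) (tsupport_lap_subset.trans hφ0), ?_⟩
  rw [integral_mul_lap hU hlap hφ hφc hφ0]
  refine integral_congr_ae (Eventually.of_forall fun x => ?_)
  by_cases hx : x ∈ tsupport φ
  · simp only
    rw [← heq x (hφ0 hx)]
    rfl
  · simp [image_eq_zero_of_notMem_tsupport hx]

lemma continuousOn_rpow_solution {p : ℝ} (hp : 0 ≤ p) {u : EuclideanSpace ℝ (Fin n) → ℝ}
    (hreg : ContDiffOn ℝ 4 u {(0 : EuclideanSpace ℝ (Fin n))}ᶜ) :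
    ContinuousOn (fun x => u x ^ p) {0}ᶜ :=
  hreg.continuousOn.rpow_const fun _ _ => Or.inr hp

lemma exists_lintegral_annulus_rpow_le {p : ℝ} (hp : 1 < p)
    {u : EuclideanSpace ℝ (Fin n) → ℝ}
    (hreg : ContDiffOn ℝ 4 u {(0 : EuclideanSpace ℝ (Fin n))}ᶜ)
    (hpos : ∀ x : EuclideanSpace ℝ (Fin n), x ≠ 0 → 0 ≤ u x)
    (heq : ∀ x : EuclideanSpace ℝ (Fin n), x ≠ 0 → bilap u x = u x ^ p) :
    ∃ C, 0 ≤ C ∧ ∀ r, 0 < r → ∫⁻ x in {x | r ≤ ‖x‖ ∧ ‖x‖ ≤ 2 * r}, ‖u x ^ p‖ₑ ≤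
      ENNReal.ofReal (C * r ^ (n - 4 - 4 / (p - 1))) := by
  have hp1 : 0 < p - 1 := by linarith
  have hU : IsOpen ({0}ᶜ : Set (EuclideanSpace ℝ (Fin n))) := isOpen_compl_singleton
  obtain ⟨η, hη, hη0, hη1, hη12, hηin, hηout⟩ := exists_annular_cutoff (n := n)
  obtain ⟨k, hk⟩ := exists_nat_ge (4 / (p - 1))
  have hk0 : k ≠ 0 := by
    rintro rfl
    have : 0 < 4 / (p - 1) := by positivity
    simp only [Nat.cast_zero] at hk
    linarith
  have hηc : HasCompactSupport η := hasCompactSupport_of_norm_lt fun x hx => hηout x hx.le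
  obtain ⟨B, hB, hBb⟩ := exists_bilap_pow k hη hη0 hηc
  set ω := volume.real (ball (0 : EuclideanSpace ℝ (Fin n)) 1) with hω
  have hω0 : 0 ≤ ω := measureReal_nonneg
  refine ⟨2 * (B * (2 * B) ^ (1 / (p - 1)) * (3 ^ n * ω)), by positivity, fun r hr => ?_⟩
  have hri : 0 < r⁻¹ := inv_pos.2 hr
  have hnorm : ∀ x : EuclideanSpace ℝ (Fin n), ‖r⁻¹ • (x - 0)‖ = ‖x‖ / r := fun x => by
    rw [sub_zero, norm_smul, Real.norm_eq_abs, abs_of_pos hri, div_eq_inv_mul]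
  set χ : EuclideanSpace ℝ (Fin n) → ℝ := fun x => η (r⁻¹ • (x - 0)) with hχ
  set ψ : EuclideanSpace ℝ (Fin n) → ℝ := fun x => χ x ^ (k + 4) with hψ
  have hχin : ∀ x, ‖x‖ < r / 2 → χ x = 0 := fun x hx => hηin _ (by
    rw [hnorm, div_lt_iff₀ hr]
    linarith)
  have hχout : ∀ x, 3 * r ≤ ‖x‖ → χ x = 0 := fun x hx => hηout _ (by
    rw [hnorm, le_div_iff₀ hr]
    linarith)
  have hψs : ContDiff ℝ (⊤ : ℕ∞) ψ := (contDiff_comp_dilation _ 0 hη).pow _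
  have hψc : HasCompactSupport ψ := hasCompactSupport_of_norm_lt (R := 3 * r) fun x hx => by
    simp only [hψ]
    rw [hχout x hx.le, zero_pow (by omega)]
  have hψ0 : tsupport ψ ⊆ {0}ᶜ :=
    tsupport_subset_compl_singleton (half_pos hr) fun x hx => by
      simp only [hψ]
      rw [hχin x hx, zero_pow (by omega)]
  have hbilap : ∀ x, bilap ψ x = (r⁻¹) ^ 4 * bilap (fun x => η x ^ (k + 4)) (r⁻¹ • (x - 0)) := by
    intro x
    unfold bilap
    have e1 := lap_comp_dilation r⁻¹ 0 (f := fun x => η x ^ (k + 4)) (hη.pow _)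
    have e2 := lap_comp_dilation r⁻¹ 0 (f := lap fun x => η x ^ (k + 4))
      (lap_contDiff (hη.pow _))
    have e3 := lap_const_mul (r⁻¹ ^ 2) (contDiff_comp_dilation r⁻¹ 0
      (lap_contDiff (hη.pow (k + 4))))
    have e4 : lap ψ = _ := e1
    rw [e4, e3, e2]
    ring
  set b : ℝ := r⁻¹ ^ 4 * B with hb
  have hb0 : 0 < b := by positivity
  set K : ℝ := b * (2 * b) ^ (1 / (p - 1)) with hK
  have hK0 : 0 ≤ K := by positivity
  have hpt : ∀ x, u x * bilap ψ x ≤ 1 / 2 * (u x ^ p * ψ x) +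
      (closedBall 0 (3 * r)).indicator (fun _ => K) x := by
    intro x
    have hb1 : |bilap ψ x| ≤ b * χ x ^ k := by
      rw [hbilap, abs_mul, abs_of_pos (by positivity), hb, mul_assoc]
      exact mul_le_mul_of_nonneg_left (hBb _) (by positivity)
    by_cases hx0 : χ x = 0
    · have h1 : bilap ψ x = 0 := by
        rw [hx0, zero_pow hk0, mul_zero] at hb1
        exact abs_nonpos_iff.1 hb1
      have h2 : ψ x = 0 := by
        simp only [hψ]
        rw [hx0, zero_pow (by omega)]
      rw [h1, h2]
      simpa using Set.indicator_nonneg (fun _ _ => hK0) x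
    · have hxb : x ∈ closedBall (0 : EuclideanSpace ℝ (Fin n)) (3 * r) := by
        by_contra h
        exact hx0 (hχout x (by simpa using (not_le.1 (by simpa using h)).le))
      have hxne : x ≠ 0 := by
        rintro rfl
        exact hx0 (hχin 0 (by simpa using hr))
      rw [Set.indicator_of_mem hxb]
      have hu := hpos x hxne
      have h3 := mul_pow_le_half_rpow_mul_pow_add (k := k) hp hu (hη0 _ : 0 ≤ χ x) (hη1 _) hb0 hk
      have h4 := mul_le_mul_of_nonneg_left ((le_abs_self _).trans hb1) hu
      simp only [hψ]
      linarith
  have hup : ContinuousOn (fun x => u x ^ p) {0}ᶜ := continuousOn_rpow_solution (by linarith) hreg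
  have hi1 : Integrable fun x => u x ^ p * ψ x :=
    integrable_mul_of_tsupport_subset hU hup hψs.continuous hψc hψ0
  have hi2 : Integrable fun x => u x * bilap ψ x :=
    integrable_mul_of_tsupport_subset hU hreg.continuousOn
      (lap_contDiff (lap_contDiff hψs)).continuous
      (lap_hasCompactSupport (lap_hasCompactSupport hψc))
      (tsupport_lap_subset.trans (tsupport_lap_subset.trans hψ0))
  have hi3 : Integrable ((closedBall (0 : EuclideanSpace ℝ (Fin n)) (3 * r)).indicator
      fun _ => K) :=
    (integrableOn_const measure_closedBall_lt_top.ne).integrable_indicator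
      measurableSet_closedBall
  have hgreen := integral_mul_bilap_eq hreg heq hψs hψc hψ0
  have hle := integral_mono hi2 ((hi1.const_mul (1 / 2)).add hi3) hpt
  have hadd : ∫ x, (1 / 2 * (u x ^ p * ψ x) + (closedBall 0 (3 * r)).indicator (fun _ => K) x) =
      1 / 2 * (∫ x, u x ^ p * ψ x) + (3 * r) ^ n * ω * K := by
    rw [integral_add (hi1.const_mul (1 / 2)) hi3, integral_const_mul,
      integral_indicator measurableSet_closedBall, setIntegral_const, Measure.real,
      volume_closedBall_eq (by positivity), ENNReal.toReal_ofReal (by positivity)]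
    rfl
  have hle' : ∫ x, u x ^ p * ψ x ≤ 1 / 2 * (∫ x, u x ^ p * ψ x) + (3 * r) ^ n * ω * K := by
    calc ∫ x, u x ^ p * ψ x = ∫ x, u x * bilap ψ x := (hgreen.1.trans hgreen.2).symm
      _ ≤ ∫ x, (1 / 2 * (u x ^ p * ψ x) + (closedBall 0 (3 * r)).indicator (fun _ => K) x) := hle
      _ = _ := hadd
  refine lintegral_annulus_le_of_integral (f := fun x => u x ^ p) (ψ := ψ) (fun x => ?_) hi1
    (fun x h1 h2 => ?_) ?_
  · by_cases hx : x = 0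
    · have : ψ x = 0 := by
        simp only [hψ]
        rw [hχin x (by simpa [hx] using hr), zero_pow (by omega)]
      rw [this, mul_zero]
    · exact mul_nonneg (Real.rpow_nonneg (hpos x hx) p) (pow_nonneg (hη0 _) _)
  · simp only [hψ, hχ]
    rw [hη12, one_pow]
    · rw [hnorm, le_div_iff₀ hr]
      linarith
    · rw [hnorm, div_le_iff₀ hr]
      linarith
  · have hKe : (3 * r) ^ n * ω * K =
        B * (2 * B) ^ (1 / (p - 1)) * (3 ^ n * ω) * r ^ (n - 4 - 4 / (p - 1)) := by
      have e1 : (2 * b) ^ (1 / (p - 1)) = (2 * B) ^ (1 / (p - 1)) * r ^ (-(4 / (p - 1))) := by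
        rw [hb, show 2 * (r⁻¹ ^ 4 * B) = 2 * B * r⁻¹ ^ 4 by ring,
          Real.mul_rpow (by positivity) (by positivity), ← Real.rpow_natCast,
          ← Real.rpow_mul hri.le, Real.inv_rpow hr.le, Real.rpow_neg hr.le]
        congr 3
        push_cast
        ring
      have e2 : r ^ ((n : ℝ) - 4 - 4 / (p - 1)) = r ^ n * (r⁻¹) ^ 4 * r ^ (-(4 / (p - 1))) := by
        rw [sub_eq_add_neg, Real.rpow_add hr, Real.rpow_sub hr, Real.rpow_natCast,
          show (4 : ℝ) = ((4 : ℕ) : ℝ) by norm_num, Real.rpow_natCast, inv_pow, div_eq_mul_inv]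
      rw [hK, e1, e2, mul_pow, hb]
      ring
    rw [mul_assoc, ← hKe]
    linarith

lemma lintegral_annulus_le_of_rpow {p C : ℝ} (hp : 1 < p) (hC : 0 ≤ C)
    {u : EuclideanSpace ℝ (Fin n) → ℝ}
    (hpos : ∀ x : EuclideanSpace ℝ (Fin n), x ≠ 0 → 0 ≤ u x)
    (h : ∀ r, 0 < r → ∫⁻ x in {x | r ≤ ‖x‖ ∧ ‖x‖ ≤ 2 * r}, ‖u x ^ p‖ₑ ≤
      ENNReal.ofReal (C * r ^ (n - 4 - 4 / (p - 1)))) :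
    ∃ C', 0 ≤ C' ∧ ∀ r, 0 < r → ∫⁻ x in {x | r ≤ ‖x‖ ∧ ‖x‖ ≤ 2 * r}, ‖u x‖ₑ ≤
      ENNReal.ofReal (C' * r ^ (n - 4 / (p - 1))) := by
  set ω := volume.real (ball (0 : EuclideanSpace ℝ (Fin n)) 1) with hω
  have hω0 : 0 ≤ ω := measureReal_nonneg
  refine ⟨C + 2 ^ n * ω, by positivity, fun r hr => ?_⟩
  calc ∫⁻ x in {x | r ≤ ‖x‖ ∧ ‖x‖ ≤ 2 * r}, ‖u x‖ₑ
      ≤ ∫⁻ x in {x | r ≤ ‖x‖ ∧ ‖x‖ ≤ 2 * r}, (ENNReal.ofReal (r ^ 4) * ‖u x ^ p‖ₑ +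
          ENNReal.ofReal (r ^ (-(4 / (p - 1))))) := by
        refine setLIntegral_mono' (measurableSet_annulus r) fun x hx => ?_
        have hx0 : x ≠ 0 := norm_pos_iff.1 (hr.trans_le hx.1)
        have hu := hpos x hx0
        rw [Real.enorm_of_nonneg hu, Real.enorm_of_nonneg (Real.rpow_nonneg hu p),
          ← ENNReal.ofReal_mul (by positivity), ← ENNReal.ofReal_add (by positivity)
          (by positivity)]
        exact ENNReal.ofReal_le_ofReal (le_pow_four_mul_rpow_add hp hu hr)
    _ = ENNReal.ofReal (r ^ 4) * (∫⁻ x in {x | r ≤ ‖x‖ ∧ ‖x‖ ≤ 2 * r}, ‖u x ^ p‖ₑ) +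
          ENNReal.ofReal (r ^ (-(4 / (p - 1)))) *
            volume {x : EuclideanSpace ℝ (Fin n) | r ≤ ‖x‖ ∧ ‖x‖ ≤ 2 * r} := by
        rw [lintegral_add_right _ measurable_const, setLIntegral_const,
          lintegral_const_mul' _ _ ENNReal.ofReal_ne_top]
    _ ≤ ENNReal.ofReal (r ^ 4) * ENNReal.ofReal (C * r ^ (n - 4 - 4 / (p - 1))) +
          ENNReal.ofReal (r ^ (-(4 / (p - 1)))) * ENNReal.ofReal ((2 * r) ^ n * ω) := by
        gcongr
        · exact h r hr
        · rw [hω, ← volume_closedBall_eq (by positivity)]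
          exact measure_mono fun x hx => by simpa using hx.2
    _ = ENNReal.ofReal ((C + 2 ^ n * ω) * r ^ (n - 4 / (p - 1))) := by
        rw [← ENNReal.ofReal_mul (by positivity), ← ENNReal.ofReal_mul (by positivity),
          ← ENNReal.ofReal_add (by positivity) (by positivity)]
        congr 1
        have e1 : r ^ ((n : ℝ) - 4 / (p - 1)) = r ^ n * r ^ (-(4 / (p - 1))) := by
          rw [sub_eq_add_neg, Real.rpow_add hr, Real.rpow_natCast]
        have e2 : r ^ ((n : ℝ) - 4 / (p - 1)) = r ^ 4 * r ^ ((n : ℝ) - 4 - 4 / (p - 1)) := by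
          rw [← Real.rpow_natCast r 4, ← Real.rpow_add hr]
          congr 1
          push_cast
          ring
        rw [add_mul]
        nth_rewrite 1 [e2]
        rw [e1, mul_pow]
        ring

end Solutions

section TestFunction

/-- The power `t ^ (-c)`, smoothly cut off near the nonpositive half-line. -/
noncomputable def cutoffPow (c t : ℝ) : ℝ :=
  t ^ (-c) * Real.smoothTransition (2 * t - 1)

/-- The defect of `cutoffPow c` in the Euler equation `t w' + c w = 0`. -/
noncomputable def cutoffPowDefect (c t : ℝ) : ℝ :=
  t * deriv (cutoffPow c) t + c * cutoffPow c t

lemma cutoffPow_of_lt {c t : ℝ} (ht : t < 1 / 2) : cutoffPow c t = 0 := by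
  rw [cutoffPow, Real.smoothTransition.zero_of_nonpos (by linarith), mul_zero]

lemma cutoffPow_eventuallyEq_zero {c t : ℝ} (ht : t < 1 / 2) :
    cutoffPow c =ᶠ[nhds t] fun _ => 0 := by
  filter_upwards [Iio_mem_nhds ht] with s hs
  exact cutoffPow_of_lt hs

lemma contDiff_smoothTransition_affine :
    ContDiff ℝ (⊤ : ℕ∞) fun t : ℝ => Real.smoothTransition (2 * t - 1) :=
  Real.smoothTransition.contDiff.comp ((contDiff_const.mul contDiff_id).sub contDiff_const)

lemma cutoffPow_contDiff (c : ℝ) : ContDiff ℝ (⊤ : ℕ∞) (cutoffPow c) := by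
  rw [contDiff_iff_contDiffAt]
  intro t
  rcases lt_or_ge t (1 / 2) with ht | ht
  · exact contDiffAt_const.congr_of_eventuallyEq (cutoffPow_eventuallyEq_zero ht)
  · exact (Real.contDiffAt_rpow_const_of_ne (by linarith)).mul
      contDiff_smoothTransition_affine.contDiffAt

lemma cutoffPowDefect_contDiff (c : ℝ) : ContDiff ℝ (⊤ : ℕ∞) (cutoffPowDefect c) :=
  (contDiff_id.mul (contDiff_infty_iff_deriv.1 (cutoffPow_contDiff c)).2).add
    (contDiff_const.mul (cutoffPow_contDiff c))

lemma cutoffPowDefect_of_pos {c t : ℝ} (ht : 0 < t) : cutoffPowDefect c t =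
    t ^ (1 - c) * deriv (fun s : ℝ => Real.smoothTransition (2 * s - 1)) t := by
  have h1 : HasDerivAt (fun s : ℝ => s ^ (-c)) (-c * t ^ (-c - 1)) t :=
    Real.hasDerivAt_rpow_const (Or.inl ht.ne')
  have h2 : HasDerivAt (fun s : ℝ => Real.smoothTransition (2 * s - 1)) _ t :=
    (contDiff_smoothTransition_affine.differentiable (by simp) t).hasDerivAt
  have h3 : deriv (cutoffPow c) t = _ := (h1.mul h2).deriv
  rw [cutoffPowDefect, h3, cutoffPow, Real.rpow_sub_one ht.ne', sub_eq_add_neg 1 c,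
    Real.rpow_add ht, Real.rpow_one]
  field_simp
  ring

lemma cutoffPowDefect_of_lt {c t : ℝ} (ht : t < 1 / 2) : cutoffPowDefect c t = 0 := by
  rw [cutoffPowDefect, (cutoffPow_eventuallyEq_zero ht).deriv_eq, cutoffPow_of_lt ht]
  simp

lemma cutoffPowDefect_of_one_lt {c t : ℝ} (ht : 1 < t) : cutoffPowDefect c t = 0 := by
  have h : (fun s : ℝ => Real.smoothTransition (2 * s - 1)) =ᶠ[nhds t] fun _ => 1 := by
    filter_upwards [Ioi_mem_nhds ht] with s hs
    exact Real.smoothTransition.one_of_one_le (by linarith [Set.mem_Ioi.1 hs])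
  rw [cutoffPowDefect_of_pos (by linarith), h.deriv_eq]
  simp

lemma cutoffPowDefect_nonneg (c t : ℝ) : 0 ≤ cutoffPowDefect c t := by
  rcases lt_or_ge t (1 / 2) with ht | ht
  · rw [cutoffPowDefect_of_lt ht]
  · have hmono : Monotone fun s : ℝ => Real.smoothTransition (2 * s - 1) := fun a b hab =>
      Real.smoothTransition.monotone (by linarith)
    rw [cutoffPowDefect_of_pos (by linarith)]
    exact mul_nonneg (Real.rpow_nonneg (by linarith) _) hmono.deriv_nonneg

lemma exists_cutoffPowDefect_ne_zero (c : ℝ) : ∃ t, 0 < t ∧ cutoffPowDefect c t ≠ 0 := by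
  have hs := contDiff_smoothTransition_affine
  obtain ⟨t, ht, h⟩ := exists_deriv_eq_slope (fun s : ℝ => Real.smoothTransition (2 * s - 1))
    (show (1 / 2 : ℝ) < 1 by norm_num) hs.continuous.continuousOn
    (hs.differentiable (by simp)).differentiableOn
  have ht0 : 0 < t := by linarith [ht.1]
  refine ⟨t, ht0, ?_⟩
  rw [cutoffPowDefect_of_pos ht0, h]
  have := Real.rpow_pos_of_pos ht0 (1 - c)
  norm_num [Real.smoothTransition.zero, Real.smoothTransition.one, this.ne']

/-- The difference between `cutoffPow c` and its `c`-homogeneous rescaling by `ρ`. -/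
noncomputable def cutoffPowGap (c ρ t : ℝ) : ℝ :=
  cutoffPow c t - ρ ^ (-c) * cutoffPow c (ρ⁻¹ * t)

lemma cutoffPowGap_contDiff (c ρ : ℝ) : ContDiff ℝ (⊤ : ℕ∞) (cutoffPowGap c ρ) :=
  (cutoffPow_contDiff c).sub
    (contDiff_const.mul ((cutoffPow_contDiff c).comp (contDiff_const.mul contDiff_id)))

lemma cutoffPowGap_eq {c ρ t : ℝ} (hρ : 0 < ρ) (ht : 0 < t) : cutoffPowGap c ρ t =
    t ^ (-c) * (Real.smoothTransition (2 * t - 1) -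
      Real.smoothTransition (2 * (ρ⁻¹ * t) - 1)) := by
  have h := Real.rpow_pos_of_pos hρ (-c)
  rw [cutoffPowGap, cutoffPow, cutoffPow, Real.mul_rpow (inv_pos.2 hρ).le ht.le,
    Real.inv_rpow hρ.le]
  field_simp

lemma cutoffPowGap_nonneg {c ρ : ℝ} (hρ : 1 ≤ ρ) (t : ℝ) : 0 ≤ cutoffPowGap c ρ t := by
  have hρ0 : 0 < ρ := by linarith
  rcases le_or_gt t 0 with ht | ht
  · rw [cutoffPowGap, cutoffPow_of_lt (by linarith), cutoffPow_of_lt]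
    · simp
    · linarith [mul_nonpos_of_nonneg_of_nonpos (inv_pos.2 hρ0).le ht]
  · rw [cutoffPowGap_eq hρ0 ht]
    refine mul_nonneg (Real.rpow_nonneg ht.le _) (sub_nonneg.2 ?_)
    apply Real.smoothTransition.monotone
    have := mul_le_mul_of_nonneg_right (inv_le_one_of_one_le₀ hρ) ht.le
    linarith

lemma cutoffPowGap_of_le {c ρ t : ℝ} (hρ : 1 ≤ ρ) (ht : ρ ≤ t) : cutoffPowGap c ρ t = 0 := by
  have hρ0 : 0 < ρ := by linarith
  have h1 : 1 ≤ ρ⁻¹ * t := by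
    rw [← div_eq_inv_mul, le_div_iff₀ hρ0]
    linarith
  rw [cutoffPowGap_eq hρ0 (hρ0.trans_le ht), Real.smoothTransition.one_of_one_le (by linarith),
    Real.smoothTransition.one_of_one_le (by linarith), sub_self, mul_zero]

lemma mul_deriv_cutoffPowGap_add (c ρ t : ℝ) :
    t * deriv (cutoffPowGap c ρ) t + c * cutoffPowGap c ρ t =
      cutoffPowDefect c t - ρ ^ (-c) * cutoffPowDefect c (ρ⁻¹ * t) := by
  have hd := (cutoffPow_contDiff c).differentiable (by simp)
  have h1 : HasDerivAt (fun s => cutoffPow c (ρ⁻¹ * s)) (deriv (cutoffPow c) (ρ⁻¹ * t) * ρ⁻¹) t :=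
    (hd (ρ⁻¹ * t)).hasDerivAt.comp t (by simpa using (hasDerivAt_id t).const_mul ρ⁻¹)
  have h2 : deriv (cutoffPowGap c ρ) t = _ :=
    ((hd t).hasDerivAt.sub (h1.const_mul (ρ ^ (-c)))).deriv
  rw [h2, cutoffPowGap, cutoffPowDefect, cutoffPowDefect]
  ring

lemma exists_primitive_cutoffPowGap {c ρ : ℝ} (hρ : 1 ≤ ρ) : ∃ h : ℝ → ℝ,
    ContDiff ℝ (⊤ : ℕ∞) h ∧ (∀ t, 0 ≤ h t) ∧ (∀ t, ρ ≤ t → h t = 0) ∧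
      deriv h = fun t => -cutoffPowGap c ρ t := by
  have hW := cutoffPowGap_contDiff c ρ
  have hd : ∀ t, HasDerivAt (fun t => ∫ s in t..ρ, cutoffPowGap c ρ s) (-cutoffPowGap c ρ t) t :=
    fun t => intervalIntegral.integral_hasDerivAt_left (hW.continuous.intervalIntegrable _ _)
      (hW.continuous.stronglyMeasurableAtFilter _ _)
        hW.continuous.continuousAt
  have hd' : deriv (fun t => ∫ s in t..ρ, cutoffPowGap c ρ s) = fun t => -cutoffPowGap c ρ t :=
    funext fun t => (hd t).deriv
  have h0 : ∀ t, ρ ≤ t → ∫ s in t..ρ, cutoffPowGap c ρ s = 0 := fun t ht => by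
    rw [intervalIntegral.integral_congr (g := fun _ => 0), intervalIntegral.integral_zero]
    intro s hs
    rw [Set.uIcc_of_ge ht] at hs
    exact cutoffPowGap_of_le hρ hs.1
  refine ⟨fun t => ∫ s in t..ρ, cutoffPowGap c ρ s, ?_, fun t => ?_, h0, hd'⟩
  · rw [contDiff_infty_iff_deriv, hd']
    exact ⟨fun t => (hd t).differentiableAt, hW.neg⟩
  · rcases le_total t ρ with ht | ht
    · exact intervalIntegral.integral_nonneg ht fun s _ => cutoffPowGap_nonneg hρ s
    · exact (h0 t ht).ge

variable {n : ℕ}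

lemma pd_comp_norm_sq (i : Fin n) {h : ℝ → ℝ} (hh : ContDiff ℝ (⊤ : ℕ∞) h) :
    pd i (fun x : EuclideanSpace ℝ (Fin n) => h (‖x‖ ^ 2)) =
      fun x => deriv h (‖x‖ ^ 2) * (2 * x i) := by
  funext x
  have h1 := ((hh.differentiable (by simp) (‖x‖ ^ 2)).hasDerivAt).comp_hasFDerivAt x
    (hasStrictFDerivAt_norm_sq x).hasFDerivAt
  have h2 : fderiv ℝ (fun x : EuclideanSpace ℝ (Fin n) => h (‖x‖ ^ 2)) x = _ := h1.fderiv
  rw [pd, h2]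
  simp [EuclideanSpace.inner_single_right]

lemma pd_two_mul_apply (i : Fin n) :
    pd i (fun x : EuclideanSpace ℝ (Fin n) => 2 * x i) = fun _ => 2 := by
  funext x
  have h : HasFDerivAt (fun x : EuclideanSpace ℝ (Fin n) => 2 * x i)
      ((2 : ℝ) • (EuclideanSpace.proj i : EuclideanSpace ℝ (Fin n) →L[ℝ] ℝ)) x :=
    (EuclideanSpace.proj i : EuclideanSpace ℝ (Fin n) →L[ℝ] ℝ).hasFDerivAt.const_mul 2
  rw [pd, h.fderiv]
  simp

lemma contDiff_comp_norm_sq {h : ℝ → ℝ} (hh : ContDiff ℝ (⊤ : ℕ∞) h) :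
    ContDiff ℝ (⊤ : ℕ∞) fun x : EuclideanSpace ℝ (Fin n) => h (‖x‖ ^ 2) :=
  hh.comp (contDiff_norm_sq ℝ)

lemma lap_comp_norm_sq {h : ℝ → ℝ} (hh : ContDiff ℝ (⊤ : ℕ∞) h) :
    lap (fun x : EuclideanSpace ℝ (Fin n) => h (‖x‖ ^ 2)) = fun x =>
      4 * (‖x‖ ^ 2 * deriv (deriv h) (‖x‖ ^ 2) + n / 2 * deriv h (‖x‖ ^ 2)) := by
  have hh' := (contDiff_infty_iff_deriv.1 hh).2
  have hc : ∀ i : Fin n, ContDiff ℝ (⊤ : ℕ∞) fun x : EuclideanSpace ℝ (Fin n) => 2 * x i :=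
    fun i => contDiff_const.mul (EuclideanSpace.proj i : EuclideanSpace ℝ (Fin n) →L[ℝ] ℝ).contDiff
  rw [lap_eq_sum_pd (contDiff_comp_norm_sq hh)]
  funext x
  have hterm : ∀ i : Fin n,
      pd i (pd i fun x : EuclideanSpace ℝ (Fin n) => h (‖x‖ ^ 2)) x =
        4 * deriv (deriv h) (‖x‖ ^ 2) * x i ^ 2 + 2 * deriv h (‖x‖ ^ 2) := fun i => by
    rw [pd_comp_norm_sq i hh, pd_mul i (contDiff_comp_norm_sq hh') (hc i),
      pd_comp_norm_sq i hh', pd_two_mul_apply]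
    ring
  rw [Finset.sum_congr rfl fun i _ => hterm i, Finset.sum_add_distrib, ← Finset.mul_sum,
    EuclideanSpace.real_norm_sq_eq]
  simp only [Finset.sum_const, Finset.card_univ, Fintype.card_fin, nsmul_eq_mul]
  ring

lemma exists_bump_sub_rescaled_bump_eq_neg_lap : ∃ B : EuclideanSpace ℝ (Fin n) → ℝ,
    ContDiff ℝ (⊤ : ℕ∞) B ∧ (∀ x, 0 ≤ B x) ∧ (∀ x, 1 < ‖x‖ → B x = 0) ∧
      (0 < n → ∃ x, B x ≠ 0) ∧ ∀ R, 1 ≤ R → ∃ Φ : EuclideanSpace ℝ (Fin n) → ℝ,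
        ContDiff ℝ (⊤ : ℕ∞) Φ ∧ HasCompactSupport Φ ∧ (∀ x, 0 ≤ Φ x) ∧
          ∀ x, lap Φ x = -B x + (R ^ n)⁻¹ * B (R⁻¹ • x) := by
  refine ⟨fun x => 4 * cutoffPowDefect (n / 2) (‖x‖ ^ 2),
    contDiff_const.mul (contDiff_comp_norm_sq (cutoffPowDefect_contDiff _)),
    fun x => mul_nonneg (by norm_num) (cutoffPowDefect_nonneg _ _), fun x hx => ?_, fun hn => ?_,
    fun R hR => ?_⟩
  · beta_reduce
    rw [cutoffPowDefect_of_one_lt (one_lt_pow₀ hx two_ne_zero), mul_zero]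
  · obtain ⟨t, ht, h⟩ := exists_cutoffPowDefect_ne_zero (n / 2)
    refine ⟨EuclideanSpace.single ⟨0, hn⟩ √t, ?_⟩
    simpa [Real.sq_sqrt ht.le] using h
  · have hR0 : 0 < R := by linarith
    have hR2 : 1 ≤ R ^ 2 := one_le_pow₀ hR
    obtain ⟨h, hh, hpos, hzero, hd⟩ := exists_primitive_cutoffPowGap (c := n / 2) hR2
    refine ⟨fun x => h (‖x‖ ^ 2), contDiff_comp_norm_sq hh,
      hasCompactSupport_of_norm_lt (R := R) fun x hx =>
        hzero _ (pow_le_pow_left₀ hR0.le hx.le 2), fun x => hpos _, fun x => ?_⟩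
    have hpow : (R ^ 2) ^ (-((n : ℝ) / 2)) = (R ^ n)⁻¹ := by
      rw [← Real.rpow_natCast R 2, ← Real.rpow_mul hR0.le, ← Real.rpow_natCast R n,
        ← Real.rpow_neg hR0.le]
      congr 1
      push_cast
      ring
    have hnorm : ‖R⁻¹ • x‖ ^ 2 = (R ^ 2)⁻¹ * ‖x‖ ^ 2 := by
      rw [norm_smul, Real.norm_eq_abs, mul_pow, sq_abs, inv_pow]
    have key := mul_deriv_cutoffPowGap_add (n / 2) (R ^ 2) (‖x‖ ^ 2)
    rw [hpow] at key
    rw [lap_comp_norm_sq hh]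
    simp only [hd, deriv.fun_neg, hnorm]
    linear_combination (-4) * key

end TestFunction

section Superharmonic

variable {n : ℕ}

lemma integral_mul_lap_bump_nonpos {u : EuclideanSpace ℝ (Fin n) → ℝ} {A γ : ℝ} (hA : 0 ≤ A)
    (hγ0 : 0 ≤ γ) (hγ : γ < n + 2) (hu : AEStronglyMeasurable u)
    (huA : ∀ r, 0 < r → ∫⁻ x in closedBall 0 r, ‖u x‖ₑ ≤ ENNReal.ofReal (A * r ^ γ))
    (hdist : ∀ φ : EuclideanSpace ℝ (Fin n) → ℝ, ContDiff ℝ (⊤ : ℕ∞) φ → HasCompactSupport φ →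
      (∀ x, 0 ≤ φ x) → 0 ≤ ∫ x, u x * bilap φ x)
    {B : EuclideanSpace ℝ (Fin n) → ℝ} (hB : ContDiff ℝ (⊤ : ℕ∞) B)
    (hB1 : ∀ x, 1 < ‖x‖ → B x = 0)
    (hBΦ : ∀ R, 1 ≤ R → ∃ Φ : EuclideanSpace ℝ (Fin n) → ℝ,
      ContDiff ℝ (⊤ : ℕ∞) Φ ∧ HasCompactSupport Φ ∧ (∀ x, 0 ≤ Φ x) ∧
        ∀ x, lap Φ x = -B x + (R ^ n)⁻¹ * B (R⁻¹ • x))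
    (x : EuclideanSpace ℝ (Fin n)) {δ : ℝ} (hδ : 0 < δ) :
    ∫ y, u y * lap (fun y => B (δ⁻¹ • (y - x))) y ≤ 0 := by
  have hBc : HasCompactSupport B := hasCompactSupport_of_norm_lt hB1
  obtain ⟨M, hM, hMB⟩ := exists_bound_of_contDiff (lap_contDiff hB) (lap_hasCompactSupport hBc)
  have hts : tsupport B ⊆ closedBall 0 1 := by
    refine closure_minimal (fun z hz => ?_) isClosed_closedBall
    by_contra h
    exact hz (hB1 z (by simpa using h))
  have hlap0 : ∀ z, 1 < ‖z‖ → lap B z = 0 := fun z hz =>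
    image_eq_zero_of_notMem_tsupport fun h => by
      have := hts (tsupport_lap_subset h)
      rw [mem_closedBall_zero_iff] at this
      linarith
  set ρ : ℝ → EuclideanSpace ℝ (Fin n) → ℝ := fun d y => B (d⁻¹ • (y - x)) with hρ
  have hρs : ∀ d, ContDiff ℝ (⊤ : ℕ∞) (ρ d) := fun d => contDiff_comp_dilation _ x hB
  have hest : ∀ d, 0 < d → (Integrable fun y => u y * lap (ρ d) y) ∧
      |∫ y, u y * lap (ρ d) y| ≤ d⁻¹ ^ 2 * M * (A * (‖x‖ + d) ^ γ) := by
    intro d hd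
    have e : lap (ρ d) = _ := lap_comp_dilation d⁻¹ x hB
    refine integrable_mul_and_abs_integral_le (r := ‖x‖ + d) hu (by positivity) (by positivity)
      (huA _ (by positivity)) (lap_contDiff (hρs d)).continuous (fun y => ?_) fun y hy => ?_
    · rw [e, abs_mul, abs_of_nonneg (by positivity)]
      exact mul_le_mul_of_nonneg_left (hMB _) (by positivity)
    · rw [e]
      beta_reduce
      rw [hlap0, mul_zero]
      rw [norm_smul, norm_inv, Real.norm_eq_abs, abs_of_pos hd, ← div_eq_inv_mul, lt_div_iff₀ hd]
      have := norm_sub_norm_le y x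
      linarith
  have hcomp : ∀ R, 1 ≤ R →
      ∫ y, u y * lap (ρ δ) y ≤ (R ^ n)⁻¹ * ∫ y, u y * lap (ρ (R * δ)) y := by
    intro R hR
    have hR0 : 0 < R := by linarith
    obtain ⟨Φ, hΦ, hΦc, hΦ0, hΦl⟩ := hBΦ R hR
    have e1 : lap (fun y => Φ (δ⁻¹ • (y - x))) = fun y =>
        δ⁻¹ ^ 2 * (-1 * ρ δ y + (R ^ n)⁻¹ * ρ (R * δ) y) := by
      rw [lap_comp_dilation δ⁻¹ x hΦ]
      funext y
      rw [hΦl, smul_smul, ← mul_inv]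
      simp only [hρ]
      ring
    have e2 : ∀ y, u y * bilap (fun y => Φ (δ⁻¹ • (y - x))) y =
        δ⁻¹ ^ 2 * ((R ^ n)⁻¹ * (u y * lap (ρ (R * δ)) y) - u y * lap (ρ δ) y) := by
      intro y
      rw [bilap, e1, lap_const_mul _ ((contDiff_const.mul (hρs δ)).add
        (contDiff_const.mul (hρs (R * δ)))), lap_add (contDiff_const.mul (hρs δ))
        (contDiff_const.mul (hρs (R * δ))), lap_const_mul _ (hρs δ),
        lap_const_mul _ (hρs (R * δ))]
      ring
    have h0 := hdist _ (contDiff_comp_dilation δ⁻¹ x hΦ)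
      (hΦc.comp_homeomorph ((Homeomorph.subRight x).trans
        (Homeomorph.smulOfNeZero δ⁻¹ (inv_ne_zero hδ.ne')))) fun y => hΦ0 _
    simp_rw [e2] at h0
    rw [integral_const_mul, integral_sub ((hest _ (by positivity)).1.const_mul _) (hest δ hδ).1,
      integral_const_mul] at h0
    have := nonneg_of_mul_nonneg_right h0 (by positivity)
    linarith
  set K : ℝ := δ⁻¹ ^ 2 * M * (A * (‖x‖ + δ) ^ γ) with hK
  have hfin : ∀ R, 1 ≤ R → ∫ y, u y * lap (ρ δ) y ≤ K * R ^ (-(n + 2 - γ)) := by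
    intro R hR
    have hR0 : 0 < R := by linarith
    calc ∫ y, u y * lap (ρ δ) y ≤ (R ^ n)⁻¹ * ∫ y, u y * lap (ρ (R * δ)) y := hcomp R hR
      _ ≤ (R ^ n)⁻¹ * ((R * δ)⁻¹ ^ 2 * M * (A * (‖x‖ + R * δ) ^ γ)) := by
          gcongr
          exact (le_abs_self _).trans (hest _ (by positivity)).2
      _ ≤ (R ^ n)⁻¹ * ((R * δ)⁻¹ ^ 2 * M * (A * (R * (‖x‖ + δ)) ^ γ)) := by
          gcongr
          rw [mul_add]
          gcongr
          exact le_mul_of_one_le_left (norm_nonneg x) hR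
      _ = K * R ^ (-(n + 2 - γ)) := by
          have : R ^ (-((n : ℝ) + 2 - γ)) = R ^ γ * (R ^ n)⁻¹ * (R⁻¹) ^ 2 := by
            rw [show -((n : ℝ) + 2 - γ) = γ - n - (2 : ℕ) by push_cast; ring,
              Real.rpow_sub hR0, Real.rpow_sub hR0, Real.rpow_natCast, Real.rpow_natCast]
            field_simp
          rw [this, Real.mul_rpow hR0.le (by positivity), hK, mul_inv]
          ring
  have hlim : Tendsto (fun R : ℝ => K * R ^ (-(n + 2 - γ))) atTop (nhds 0) := by
    simpa using (tendsto_rpow_neg_atTop (by linarith : 0 < n + 2 - γ)).const_mul K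
  exact ge_of_tendsto hlim ((eventually_ge_atTop 1).mono hfin)

lemma lap_nonpos_of_forall_integral_mul_bilap_nonneg (hn : 0 < n)
    {u : EuclideanSpace ℝ (Fin n) → ℝ} {A γ : ℝ} (hA : 0 ≤ A)
    (hγ0 : 0 ≤ γ) (hγ : γ < n + 2) (hu : AEStronglyMeasurable u)
    (huA : ∀ r, 0 < r → ∫⁻ x in closedBall 0 r, ‖u x‖ₑ ≤ ENNReal.ofReal (A * r ^ γ))
    (hreg : ContDiffOn ℝ 2 u {0}ᶜ)
    (hdist : ∀ φ : EuclideanSpace ℝ (Fin n) → ℝ, ContDiff ℝ (⊤ : ℕ∞) φ → HasCompactSupport φ →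
      (∀ x, 0 ≤ φ x) → 0 ≤ ∫ x, u x * bilap φ x)
    {x : EuclideanSpace ℝ (Fin n)} (hx : x ≠ 0) : lap u x ≤ 0 := by
  have hU : IsOpen ({0}ᶜ : Set (EuclideanSpace ℝ (Fin n))) := isOpen_compl_singleton
  obtain ⟨B, hB, hB0, hB1, hBne, hBΦ⟩ := exists_bump_sub_rescaled_bump_eq_neg_lap (n := n)
  obtain ⟨z, hz⟩ := hBne hn
  by_contra! hpos
  have hcont : ContinuousOn (lap u) {0}ᶜ :=
    (lap_contDiffOn (k := 0) hU (by simpa using hreg)).continuousOn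
  have hev : ∀ᶠ y in nhds x, 0 < lap u y ∧ y ≠ 0 :=
    ((hcont.continuousAt (hU.mem_nhds hx)).eventually (lt_mem_nhds hpos)).and (hU.mem_nhds hx)
  obtain ⟨δ, hδ, hδx⟩ := Metric.nhds_basis_closedBall.mem_iff.1 hev
  set ρ : EuclideanSpace ℝ (Fin n) → ℝ := fun y => B (δ⁻¹ • (y - x)) with hρ
  have hρs : ContDiff ℝ (⊤ : ℕ∞) ρ := contDiff_comp_dilation _ x hB
  have hρt : tsupport ρ ⊆ closedBall x δ := by
    refine closure_minimal (fun y hy => ?_) isClosed_closedBall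
    by_contra h
    refine hy (hB1 _ ?_)
    rw [norm_smul, norm_inv, Real.norm_eq_abs, abs_of_pos hδ, ← div_eq_inv_mul, lt_div_iff₀ hδ,
      one_mul, ← dist_eq_norm]
    simpa using h
  have hρc : HasCompactSupport ρ := (isCompact_closedBall x δ).of_isClosed_subset
    (isClosed_tsupport ρ) hρt
  have hρU : tsupport ρ ⊆ {0}ᶜ := hρt.trans fun y hy => (hδx hy).2
  have hle : ∫ y, lap u y * ρ y ≤ 0 := by
    rw [← integral_mul_lap hU hreg hρs hρc hρU]
    exact integral_mul_lap_bump_nonpos hA hγ0 hγ hu huA hdist hB hB1 hBΦ x hδ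
  have hnonneg : ∀ y, 0 ≤ lap u y * ρ y := fun y => by
    by_cases hy : y ∈ tsupport ρ
    · exact mul_nonneg (hδx (hρt hy)).1.le (hB0 _)
    · rw [image_eq_zero_of_notMem_tsupport hy, mul_zero]
  have hρz : ρ (x + δ • z) ≠ 0 := by
    simp only [hρ]
    rwa [add_sub_cancel_left, smul_smul, inv_mul_cancel₀ hδ.ne', one_smul]
  have hgt := (continuous_mul_of_tsupport_subset hU hcont hρs.continuous
    hρU).integral_pos_of_hasCompactSupport_nonneg_nonzero (μ := volume) hρc.mul_left hnonneg
    (x := x + δ • z) (mul_ne_zero (hδx (hρt (subset_tsupport ρ hρz))).1.ne' hρz)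
  exact hle.not_gt hgt

end Superharmonic

lemma exists_lintegral_annulus_lap_le {n : ℕ} {u : EuclideanSpace ℝ (Fin n) → ℝ} {A γ : ℝ}
    (hA : 0 ≤ A) (hu : AEStronglyMeasurable u)
    (huA : ∀ r, 0 < r → ∫⁻ x in closedBall 0 r, ‖u x‖ₑ ≤ ENNReal.ofReal (A * r ^ γ))
    (hreg : ContDiffOn ℝ 2 u {0}ᶜ)
    (hlap : ∀ x : EuclideanSpace ℝ (Fin n), x ≠ 0 → lap u x ≤ 0) :
    ∃ C, 0 ≤ C ∧ ∀ r, 0 < r → ∫⁻ x in {x | r ≤ ‖x‖ ∧ ‖x‖ ≤ 2 * r}, ‖lap u x‖ₑ ≤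
      ENNReal.ofReal (C * r ^ (γ - 2)) := by
  have hU : IsOpen ({0}ᶜ : Set (EuclideanSpace ℝ (Fin n))) := isOpen_compl_singleton
  have hcont : ContinuousOn (lap u) {0}ᶜ :=
    (lap_contDiffOn (k := 0) hU (by simpa using hreg)).continuousOn
  obtain ⟨η, hη, hη0, hη1, hη12, hηin, hηout⟩ := exists_annular_cutoff (n := n)
  have hηc : HasCompactSupport η := hasCompactSupport_of_norm_lt fun x hx => hηout x hx.le
  obtain ⟨M, hM, hMη⟩ := exists_bound_of_contDiff (lap_contDiff hη) (lap_hasCompactSupport hηc)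
  refine ⟨M * (A * 3 ^ γ), by positivity, fun r hr => ?_⟩
  have hri : 0 < r⁻¹ := inv_pos.2 hr
  have hnorm : ∀ x : EuclideanSpace ℝ (Fin n), ‖r⁻¹ • (x - 0)‖ = ‖x‖ / r := fun x => by
    rw [sub_zero, norm_smul, Real.norm_eq_abs, abs_of_pos hri, div_eq_inv_mul]
  set χ : EuclideanSpace ℝ (Fin n) → ℝ := fun x => η (r⁻¹ • (x - 0)) with hχ
  have hχin : ∀ x, ‖x‖ < r / 2 → χ x = 0 := fun x hx => hηin _ (by
    rw [hnorm, div_lt_iff₀ hr]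
    linarith)
  have hχout : ∀ x, 3 * r ≤ ‖x‖ → χ x = 0 := fun x hx => hηout _ (by
    rw [hnorm, le_div_iff₀ hr]
    linarith)
  have hχs : ContDiff ℝ (⊤ : ℕ∞) χ := contDiff_comp_dilation _ 0 hη
  have hχc : HasCompactSupport χ :=
    hasCompactSupport_of_norm_lt (R := 3 * r) fun x hx => hχout x hx.le
  have hχt : tsupport χ ⊆ closedBall 0 (3 * r) := by
    refine closure_minimal (fun x hx => ?_) isClosed_closedBall
    by_contra h
    exact hx (hχout x (not_le.1 (by simpa using h)).le)
  have hχU : tsupport χ ⊆ {0}ᶜ := tsupport_subset_compl_singleton (half_pos hr) hχin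
  have hest := integrable_mul_and_abs_integral_le (ψ := lap χ) (r := 3 * r) (M := r⁻¹ ^ 2 * M) hu
    (K := A * (3 * r) ^ γ) (by positivity) (by positivity) (huA _ (by positivity))
    (lap_contDiff hχs).continuous (fun x => by
      rw [lap_comp_dilation r⁻¹ 0 hη, abs_mul, abs_of_nonneg (by positivity)]
      exact mul_le_mul_of_nonneg_left (hMη _) (by positivity)) fun x hx =>
      image_eq_zero_of_notMem_tsupport fun h => by
        have := hχt (tsupport_lap_subset h)
        rw [mem_closedBall_zero_iff] at this
        linarith
  have hint := integral_mul_lap hU hreg hχs hχc hχU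
  have hmain : ∫⁻ x in {x | r ≤ ‖x‖ ∧ ‖x‖ ≤ 2 * r}, ‖-lap u x‖ₑ ≤
      ENNReal.ofReal (M * (A * 3 ^ γ) * r ^ (γ - 2)) := by
    refine lintegral_annulus_le_of_integral (f := fun x => -lap u x) (ψ := χ) (fun x => ?_)
      (integrable_mul_of_tsupport_subset hU hcont.neg hχs.continuous hχc hχU) (fun x h1 h2 => ?_) ?_
    · by_cases hx : x = 0
      · rw [hχin x (by simpa [hx] using hr), mul_zero]
      · exact mul_nonneg (neg_nonneg.2 (hlap x hx)) (hη0 _)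
    · refine hη12 _ ?_ ?_
      · rw [hnorm, le_div_iff₀ hr]
        linarith
      · rw [hnorm, div_le_iff₀ hr]
        linarith
    · simp_rw [neg_mul]
      rw [integral_neg, ← hint]
      refine (neg_le_abs _).trans (hest.2.trans_eq ?_)
      rw [show γ - 2 = γ - (2 : ℕ) by push_cast; ring, Real.rpow_sub hr, Real.rpow_natCast,
        Real.mul_rpow (by norm_num) hr.le]
      field_simp
  simpa only [enorm_neg] using hmain

lemma four_div_sub_one_lt {a p : ℝ} (ha : 4 < a) (hp : a / (a - 4) < p) :
    1 < p ∧ 4 / (p - 1) < a - 4 := by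
  have ha' : 0 < a - 4 := by linarith
  rw [div_lt_iff₀ ha'] at hp
  have h1 : 1 < p := by
    by_contra! h
    nlinarith
  refine ⟨h1, ?_⟩
  rw [div_lt_iff₀ (by linarith)]
  linarith

/-- For a nonnegative `C⁴` solution of `Δ²u = u^p` in `ℝⁿ \ {0}` with
`n/(n-4) < p < (n+4)/(n-4)`, `-Δu` is superharmonic in `ℝⁿ` in the distributional sense:
`∫ Δu Δφ = ∫ u^p φ ≥ 0` for every nonnegative `φ ∈ C_c^∞(ℝⁿ)`; moreover `-Δu ≥ 0` on
`ℝⁿ \ {0}`. -/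
theorem stmt_7 (n : ℕ) (hn : 5 ≤ n) (p : ℝ)
    (hp1 : (n : ℝ) / ((n : ℝ) - 4) < p) (hp2 : p < ((n : ℝ) + 4) / ((n : ℝ) - 4))
    (u : EuclideanSpace ℝ (Fin n) → ℝ)
    (hreg : ContDiffOn ℝ 4 u {(0 : EuclideanSpace ℝ (Fin n))}ᶜ)
    (hpos : ∀ x : EuclideanSpace ℝ (Fin n), x ≠ 0 → 0 ≤ u x)
    (heq : ∀ x : EuclideanSpace ℝ (Fin n), x ≠ 0 → bilap u x = u x ^ p) :
    (∀ φ : EuclideanSpace ℝ (Fin n) → ℝ, ContDiff ℝ (⊤ : ℕ∞) φ → HasCompactSupport φ →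
      (∀ x, 0 ≤ φ x) →
      (∫ x, lap u x * lap φ x) = (∫ x, u x ^ p * φ x) ∧ 0 ≤ ∫ x, u x ^ p * φ x) ∧
    ∀ x : EuclideanSpace ℝ (Fin n), x ≠ 0 → 0 ≤ -lap u x := by
  have hn0 : 0 < n := by omega
  have : Nonempty (Fin n) := ⟨⟨0, hn0⟩⟩
  obtain ⟨hp, hs⟩ := four_div_sub_one_lt (by exact_mod_cast hn) hp1
  have hs0 : 0 < 4 / (p - 1) := div_pos (by norm_num) (by linarith)
  have hU : IsOpen ({0}ᶜ : Set (EuclideanSpace ℝ (Fin n))) := isOpen_compl_singleton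
  have hreg2 : ContDiffOn ℝ 2 u {0}ᶜ := hreg.of_le (by norm_num)
  have hlapc : ContinuousOn (lap u) {0}ᶜ :=
    (lap_contDiffOn (k := 0) hU (by simpa using hreg2)).continuousOn
  set α : ℝ := n - 4 - 4 / (p - 1) with hα
  have hα0 : 0 < α := by linarith
  have hum := aestronglyMeasurable_of_continuousOn_compl hn0 hreg.continuousOn
  have hupm := aestronglyMeasurable_of_continuousOn_compl hn0
    (continuousOn_rpow_solution (by linarith : 0 ≤ p) hreg)
  have hlapm := aestronglyMeasurable_of_continuousOn_compl hn0 hlapc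
  obtain ⟨C₀, hC₀, hann₀⟩ := exists_lintegral_annulus_rpow_le hp hreg hpos heq
  obtain ⟨C₁, hC₁, hann₁⟩ := lintegral_annulus_le_of_rpow hp hC₀ hpos hann₀
  obtain ⟨D₀, hD₀, hball₀⟩ := lintegral_closedBall_le_of_annuli hn0 hC₀ hα0 hann₀
  obtain ⟨D₁, hD₁, hball₁⟩ := lintegral_closedBall_le_of_annuli hn0 hC₁ (by linarith) hann₁
  have hnonneg : ∀ φ : EuclideanSpace ℝ (Fin n) → ℝ, (∀ x, 0 ≤ φ x) →
      0 ≤ ∫ x, u x ^ p * φ x := fun φ hφ0 => by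
    refine integral_nonneg_of_ae ?_
    filter_upwards [compl_mem_ae_iff.2 (measure_singleton (0 : EuclideanSpace ℝ (Fin n)))]
      with x hx
    exact mul_nonneg (Real.rpow_nonneg (hpos x hx) p) (hφ0 x)
  have hbi : ∀ φ : EuclideanSpace ℝ (Fin n) → ℝ, ContDiff ℝ (⊤ : ℕ∞) φ → HasCompactSupport φ →
      ∫ x, u x * bilap φ x = ∫ x, u x ^ p * φ x := fun φ hφ hφc => by
    refine integral_mul_lap_iterate_of_removable 2 hα0 hD₁ hD₀ hum hupm ?_ hball₀
      (fun ψ hψ hψc hψ0 => ?_) hφ hφc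
    · rwa [show α + 2 * ((2 : ℕ) : ℝ) = n - 4 / (p - 1) by rw [hα]; push_cast; ring]
    · have h := integral_mul_bilap_eq hreg heq hψ hψc hψ0
      exact h.1.trans h.2
  have hlap : ∀ x : EuclideanSpace ℝ (Fin n), x ≠ 0 → lap u x ≤ 0 := fun x hx =>
    lap_nonpos_of_forall_integral_mul_bilap_nonneg hn0 hD₁ (by linarith) (by linarith) hum hball₁
      hreg2 (fun φ hφ hφc hφ0 => (hbi φ hφ hφc).symm ▸ hnonneg φ hφ0) hx
  obtain ⟨C₂, hC₂, hann₂⟩ := exists_lintegral_annulus_lap_le hD₁ hum hball₁ hreg2 hlap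
  obtain ⟨D₂, hD₂, hball₂⟩ := lintegral_closedBall_le_of_annuli hn0 hC₂ (by linarith) hann₂
  refine ⟨fun φ hφ hφc hφ0 => ⟨?_, hnonneg φ hφ0⟩, fun x hx => neg_nonneg.2 (hlap x hx)⟩
  refine integral_mul_lap_iterate_of_removable 1 hα0 hD₂ hD₀ hlapm hupm ?_ hball₀
    (fun ψ hψ hψc hψ0 => (integral_mul_bilap_eq hreg heq hψ hψc hψ0).2) hφ hφc
  rwa [show α + 2 * ((1 : ℕ) : ℝ) = n - 4 / (p - 1) - 2 by rw [hα]; push_cast; ring]
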